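/- arXiv:2201.02169 — 4 statements merged into one kernel-verified Lean document; each statement's English description precedes it below -/
import Mathlib

section
/- Let φ_1, …, φ_t ∈ ℝ^d be such that A_t = ∑_{s=1}^t φ_s φ_sᵀ is positive definite, let r_1, …, r_t ∈ ℝ, and let θ̂_t = A_t^{-1} ∑_{s=1}^t φ_s r_s be the least-squares estimator. For θ ∈ ℝ^d let f_s^θ(r) = (2π)^{-1/2} exp(−(r − θᵀφ_s)²/2) denote the density of the Gaussian distribution N(θᵀφ_s, 1). Then for every γ ∈ ℝ^d with γ ≠ 0 and every ε ∈ ℝ, the generalized log-likelihood ratio satisfies log( sup_{θ∈ℝ^d: θᵀγ ≤ ε} ∏_{s=1}^t f_s^θ(r_s) / sup_{θ∈ℝ^d: θᵀγ ≥ ε} ∏_{s=1}^t f_s^θ(r_s) ) = sgn(ε − θ̂_tᵀγ) · (ε − θ̂_tᵀγ)² / (2 γᵀ A_t^{-1} γ). -/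
open Matrix Real

/-- Density of the Gaussian distribution `N(m, 1)` evaluated at `r`. -/
noncomputable def gaussDensity (m r : ℝ) : ℝ :=
  (2 * Real.pi) ^ (-(1 : ℝ) / 2) * Real.exp (-(r - m) ^ 2 / 2)

theorem aux_bilin {d t : ℕ} (φ : Fin t → Fin d → ℝ)
    (A : Matrix (Fin d) (Fin d) ℝ) (hA : A = ∑ s, vecMulVec (φ s) (φ s)) (u v : Fin d → ℝ) :
    u ⬝ᵥ A.mulVec v = ∑ s, (u ⬝ᵥ φ s) * (v ⬝ᵥ φ s) := by
  subst hA
  rw [Matrix.sum_mulVec, dotProduct_sum]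
  refine Finset.sum_congr rfl fun s _ => ?_
  rw [Matrix.vecMulVec_mulVec, dotProduct_comm (φ s) v]
  simp [mul_comm]

theorem aux_sup {d : ℕ} (p : (Fin d → ℝ) → Prop) (L : (Fin d → ℝ) → ℝ) (θ₀ : Fin d → ℝ)
    (h0 : p θ₀) (hmax : ∀ θ, p θ → L θ ≤ L θ₀) :
    (⨆ θ : {θ : Fin d → ℝ // p θ}, L θ.1) = L θ₀ := by
  have : Nonempty {θ : Fin d → ℝ // p θ} := ⟨⟨θ₀, h0⟩⟩
  apply le_antisymm
  · exact ciSup_le fun θ => hmax θ.1 θ.2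
  · exact le_ciSup (f := fun θ : {θ : Fin d → ℝ // p θ} => L θ.1)
      ⟨L θ₀, by rintro _ ⟨θ, rfl⟩; exact hmax θ.1 θ.2⟩ ⟨θ₀, h0⟩

/-- explicit expression of the generalized log-likelihood ratio
for unit-variance Gaussian observations in a linear model. -/
theorem stmt_3 {d t : ℕ} (φ : Fin t → Fin d → ℝ) (r : Fin t → ℝ)
    (A : Matrix (Fin d) (Fin d) ℝ) (hA : A = ∑ s, vecMulVec (φ s) (φ s))
    (hApd : A.PosDef)
    (θhat : Fin d → ℝ) (hθhat : θhat = A⁻¹.mulVec (∑ s, r s • φ s))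
    (γ : Fin d → ℝ) (hγ : γ ≠ 0) (ε : ℝ) :
    Real.log ((⨆ θ : {θ : Fin d → ℝ // θ ⬝ᵥ γ ≤ ε}, ∏ s, gaussDensity (θ.1 ⬝ᵥ φ s) (r s)) /
              (⨆ θ : {θ : Fin d → ℝ // θ ⬝ᵥ γ ≥ ε}, ∏ s, gaussDensity (θ.1 ⬝ᵥ φ s) (r s)))
      = Real.sign (ε - θhat ⬝ᵥ γ) * (ε - θhat ⬝ᵥ γ) ^ 2 / (2 * (γ ⬝ᵥ A⁻¹.mulVec γ)) := by
  set w := A⁻¹.mulVec γ with hw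
  set g := γ ⬝ᵥ w with hg
  have hdet : IsUnit A.det := hApd.det_pos.ne'.isUnit
  have hAw : A.mulVec w = γ := by
    rw [hw, Matrix.mulVec_mulVec, Matrix.mul_nonsing_inv _ hdet, Matrix.one_mulVec]
  have hAθ : A.mulVec θhat = ∑ s, r s • φ s := by
    rw [hθhat, Matrix.mulVec_mulVec, Matrix.mul_nonsing_inv _ hdet, Matrix.one_mulVec]
  have hB := aux_bilin φ A hA
  have hsymm : ∀ u v : Fin d → ℝ, u ⬝ᵥ A.mulVec v = v ⬝ᵥ A.mulVec u := by
    intro u v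
    rw [hB, hB]
    exact Finset.sum_congr rfl fun s _ => mul_comm _ _
  have hq0 : ∀ v : Fin d → ℝ, 0 ≤ v ⬝ᵥ A.mulVec v := by
    intro v
    rw [hB]
    exact Finset.sum_nonneg fun s _ => mul_self_nonneg _
  have hgw : w ⬝ᵥ A.mulVec w = g := by rw [hAw, hg, dotProduct_comm]
  have hw0 : w ≠ 0 := by
    intro h
    apply hγ
    rw [← hAw, h, Matrix.mulVec_zero]
  have hgpos : 0 < g := by
    rw [← hgw]
    simpa using hApd.dotProduct_mulVec_pos hw0
  have hCS : ∀ v : Fin d → ℝ, (v ⬝ᵥ γ) ^ 2 / g ≤ v ⬝ᵥ A.mulVec v := by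
    intro v
    have h := hq0 (v - ((v ⬝ᵥ γ) / g) • w)
    have h2 : w ⬝ᵥ A.mulVec v = v ⬝ᵥ γ := by rw [hsymm, hAw]
    rw [Matrix.mulVec_sub, Matrix.mulVec_smul, sub_dotProduct, dotProduct_sub, dotProduct_sub,
      smul_dotProduct, smul_dotProduct, dotProduct_smul, dotProduct_smul, hgw, h2, hAw] at h
    simp only [smul_eq_mul] at h
    have e : v ⬝ᵥ A.mulVec v - v ⬝ᵥ γ / g * v ⬝ᵥ γ -
      (v ⬝ᵥ γ / g * v ⬝ᵥ γ - v ⬝ᵥ γ / g * (v ⬝ᵥ γ / g * g)) =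
      v ⬝ᵥ A.mulVec v - (v ⬝ᵥ γ) ^ 2 / g := by
      field_simp
      ring
    linarith
  set L : (Fin d → ℝ) → ℝ := fun θ => ∏ s, gaussDensity (θ ⬝ᵥ φ s) (r s) with hL
  have hLpos : ∀ θ, 0 < L θ := by
    intro θ
    refine Finset.prod_pos fun s _ => ?_
    unfold gaussDensity
    positivity
  have hLform : ∀ v, L (θhat + v) = L θhat * Real.exp (-(v ⬝ᵥ A.mulVec v) / 2) := by
    intro v
    have key : ∑ s, (-(r s - (θhat + v) ⬝ᵥ φ s) ^ 2 / 2) =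
        ∑ s, (-(r s - θhat ⬝ᵥ φ s) ^ 2 / 2) + -(v ⬝ᵥ A.mulVec v) / 2 := by
      have h1 : ∑ s, (θhat ⬝ᵥ φ s) * (v ⬝ᵥ φ s) = ∑ s, r s * (v ⬝ᵥ φ s) := by
        rw [← hB, hsymm, hAθ, dotProduct_sum]
        simp
      have h3 : ∑ s, (-(r s - (θhat + v) ⬝ᵥ φ s) ^ 2 / 2) =
          ∑ s, (-(r s - θhat ⬝ᵥ φ s) ^ 2 / 2) + ∑ s, r s * (v ⬝ᵥ φ s)
          - ∑ s, (θhat ⬝ᵥ φ s) * (v ⬝ᵥ φ s) - (∑ s, (v ⬝ᵥ φ s) * (v ⬝ᵥ φ s)) / 2 := by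
        rw [Finset.sum_div, ← Finset.sum_add_distrib, ← Finset.sum_sub_distrib,
          ← Finset.sum_sub_distrib]
        refine Finset.sum_congr rfl fun s _ => ?_
        rw [add_dotProduct]
        ring
      rw [h3, h1, hB]
      ring
    simp only [hL, gaussDensity, Finset.prod_mul_distrib, ← Real.exp_sum]
    rw [key, Real.exp_add, mul_assoc]
  set x := ε - θhat ⬝ᵥ γ with hx
  have hle : ∀ θ, L θ ≤ L θhat * Real.exp (-((θ - θhat) ⬝ᵥ γ) ^ 2 / (2 * g)) := by
    intro θ
    have h := hLform (θ - θhat)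
    rw [add_sub_cancel] at h
    rw [h]
    refine mul_le_mul_of_nonneg_left (Real.exp_le_exp.2 ?_) (hLpos _).le
    have h2 := hCS (θ - θhat)
    have e : -((θ - θhat) ⬝ᵥ γ) ^ 2 / (2 * g) = -(((θ - θhat) ⬝ᵥ γ) ^ 2 / g) / 2 := by
      field_simp
    rw [e]
    linarith
  have hmax : ∀ θ, L θ ≤ L θhat := by
    intro θ
    refine (hle θ).trans (mul_le_of_le_one_right (hLpos _).le (Real.exp_le_one_iff.2 ?_))
    rw [neg_div]
    have : 0 ≤ ((θ - θhat) ⬝ᵥ γ) ^ 2 / (2 * g) := by positivity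
    linarith
  set θ₁ := θhat + (x / g) • w with hθ₁
  have hθ₁γ : θ₁ ⬝ᵥ γ = ε := by
    rw [hθ₁, add_dotProduct, smul_dotProduct, dotProduct_comm w γ, ← hg, smul_eq_mul,
      div_mul_cancel₀ _ hgpos.ne', hx]
    ring
  have hLθ₁ : L θ₁ = L θhat * Real.exp (-x ^ 2 / (2 * g)) := by
    rw [hθ₁, hLform, Matrix.mulVec_smul, smul_dotProduct, dotProduct_smul, hgw]
    congr 2
    simp only [smul_eq_mul]
    field_simp
  have hbd : ∀ θ, x ^ 2 ≤ ((θ - θhat) ⬝ᵥ γ) ^ 2 → L θ ≤ L θ₁ := by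
    intro θ h
    rw [hLθ₁]
    refine (hle θ).trans (mul_le_mul_of_nonneg_left (Real.exp_le_exp.2 ?_) (hLpos _).le)
    gcongr
  have hlog : Real.log (L θ₁) = Real.log (L θhat) + -x ^ 2 / (2 * g) := by
    rw [hLθ₁, Real.log_mul (hLpos _).ne' (Real.exp_pos _).ne', Real.log_exp]
  rcases le_total 0 x with h0 | h0
  · rw [aux_sup (fun θ => θ ⬝ᵥ γ ≤ ε) L θhat (by linarith) (fun θ _ => hmax θ),
      aux_sup (fun θ => θ ⬝ᵥ γ ≥ ε) L θ₁ hθ₁γ.ge (fun θ h => hbd θ (by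
        rw [sub_dotProduct]
        exact pow_le_pow_left₀ h0 (by linarith) 2)),
      Real.log_div (hLpos _).ne' (hLpos _).ne', hlog]
    rcases h0.eq_or_lt with h | h
    · rw [← h]; simp
    · rw [Real.sign_of_pos h]; ring
  · rw [aux_sup (fun θ => θ ⬝ᵥ γ ≥ ε) L θhat (by linarith) (fun θ _ => hmax θ),
      aux_sup (fun θ => θ ⬝ᵥ γ ≤ ε) L θ₁ hθ₁γ.le (fun θ h => hbd θ (by
        rw [sub_dotProduct]
        have h : θ ⬝ᵥ γ ≤ ε := h
        nlinarith)),
      Real.log_div (hLpos _).ne' (hLpos _).ne', hlog]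
    rcases h0.eq_or_lt with h | h
    · rw [h]; simp
    · rw [Real.sign_of_neg h]; ring
end

section
/- Let A be a symmetric positive definite d×d real matrix, let γ ∈ ℝ^d with γ ≠ 0, let ε ≥ 0, and let θ, θ̂ ∈ ℝ^d with θᵀγ > ε. Then sgn(ε − θ̂ᵀγ) · (ε − θ̂ᵀγ)² / (2 γᵀ A^{-1} γ) ≤ ½ (θ − θ̂)ᵀ A (θ − θ̂). -/
open Matrix

/-- for a symmetric positive definite `A`, nonzero `γ`, `ε ≥ 0` and `θ, θ̂`
with `θᵀγ > ε`, the GLR statistic `sgn(ε − θ̂ᵀγ) (ε − θ̂ᵀγ)² / (2 γᵀ A⁻¹ γ)` is bounded by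
`½ (θ − θ̂)ᵀ A (θ − θ̂)`. -/
theorem stmt_5 {d : ℕ} (A : Matrix (Fin d) (Fin d) ℝ) (hA : A.PosDef)
    (γ : Fin d → ℝ) (hγ : γ ≠ 0) (ε : ℝ) (hε : 0 ≤ ε)
    (θ θhat : Fin d → ℝ) (h : θ ⬝ᵥ γ > ε) :
    Real.sign (ε - θhat ⬝ᵥ γ) * (ε - θhat ⬝ᵥ γ) ^ 2 / (2 * (γ ⬝ᵥ A⁻¹.mulVec γ))
      ≤ (1 / 2) * ((θ - θhat) ⬝ᵥ A.mulVec (θ - θhat)) := by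
  have hg : 0 < γ ⬝ᵥ A⁻¹.mulVec γ := by
    simpa using hA.inv.dotProduct_mulVec_pos hγ
  have hx : 0 ≤ (θ - θhat) ⬝ᵥ A.mulVec (θ - θhat) := by
    simpa using hA.posSemidef.dotProduct_mulVec_nonneg (θ - θhat)
  have hc : (θ - θhat) ⬝ᵥ γ = θ ⬝ᵥ γ - θhat ⬝ᵥ γ := sub_dotProduct _ _ _
  have hAu : A.mulVec (A⁻¹.mulVec γ) = γ := by
    rw [mulVec_mulVec, mul_nonsing_inv _ ((isUnit_iff_isUnit_det A).1 hA.isUnit), one_mulVec]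
  have hT : Aᵀ = A := by
    simpa [IsHermitian] using hA.isHermitian
  generalize θ - θhat = x at hx hc ⊢
  have hux : (A⁻¹.mulVec γ) ⬝ᵥ A.mulVec x = x ⬝ᵥ γ := by
    rw [dotProduct_mulVec, ← mulVec_transpose, hT, hAu, dotProduct_comm]
  have key : ∀ t : ℝ, 0 ≤ x ⬝ᵥ A.mulVec x - 2 * t * (x ⬝ᵥ γ)
      + t ^ 2 * (γ ⬝ᵥ A⁻¹.mulVec γ) := by
    intro t
    have h0 : 0 ≤ (x - t • A⁻¹.mulVec γ) ⬝ᵥ A.mulVec (x - t • A⁻¹.mulVec γ) := by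
      simpa only [star_trivial] using
        hA.posSemidef.dotProduct_mulVec_nonneg (x - t • A⁻¹.mulVec γ)
    rw [mulVec_sub, mulVec_smul, hAu, sub_dotProduct, dotProduct_sub, dotProduct_sub,
      smul_dotProduct, smul_dotProduct, dotProduct_smul, dotProduct_smul, hux,
      dotProduct_comm (A⁻¹.mulVec γ) γ] at h0
    simp only [smul_eq_mul] at h0
    linarith
  generalize γ ⬝ᵥ A⁻¹.mulVec γ = g at hg key ⊢
  generalize x ⬝ᵥ A.mulVec x = q at hx key ⊢
  have hq : (x ⬝ᵥ γ) ^ 2 ≤ q * g := by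
    have h1 := mul_nonneg (key (x ⬝ᵥ γ / g)) hg.le
    have h2 : (q - 2 * (x ⬝ᵥ γ / g) * (x ⬝ᵥ γ) + (x ⬝ᵥ γ / g) ^ 2 * g) * g
        = q * g - (x ⬝ᵥ γ) ^ 2 := by
      field_simp
      ring
    linarith
  have hr : ε - θhat ⬝ᵥ γ < x ⬝ᵥ γ := by linarith
  generalize ε - θhat ⬝ᵥ γ = r at hr ⊢
  rw [div_le_iff₀ (by positivity)]
  have hqg : 0 ≤ q * g := mul_nonneg hx hg.le
  rcases lt_trichotomy r 0 with h0 | h0 | h0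
  · rw [Real.sign_of_neg h0]
    nlinarith [sq_nonneg r]
  · subst h0
    simp
    linarith
  · rw [Real.sign_of_pos h0]
    nlinarith
end

section
/- Fix ε > 0. Assume Span{φ_{x,a} : x ∈ 𝒳, a ∈ 𝒜} = ℝ^d, p_𝒳(x) > 0 for every x ∈ 𝒳, and that B̄_ε(θ) is nonempty. Then the set C*_ε(θ) = argmax_{α∈Λ} ψ̄_{θ,ε}(α) is nonempty and contains an allocation α* such that A(α*) is positive definite. -/
open Matrix Finset

noncomputable section

variable {d : ℕ} {𝒳 𝒜 : Type*} [Fintype 𝒳] [Fintype 𝒜] [Nonempty 𝒜]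

/-- Optimal value `θᵀ φ_{x, a*_θ(x)} = max_a θᵀ φ_{x,a}` in context `x`. -/
def maxVal (φ : 𝒳 → 𝒜 → Fin d → ℝ) (θ : Fin d → ℝ) (x : 𝒳) : ℝ :=
  ⨆ a : 𝒜, θ ⬝ᵥ φ x a

/-- Suboptimality gap `θᵀ(φ_{x,a*_θ(x)} − φ_{x,a})`. -/
def gap (φ : 𝒳 → 𝒜 → Fin d → ℝ) (θ : Fin d → ℝ) (x : 𝒳) (a : 𝒜) : ℝ :=
  maxVal φ θ x - θ ⬝ᵥ φ x a

open Classical in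
/-- Set `𝒜_ε(θ,x)` of ε-optimal arms (for `ε = 0`, the set of optimal arms). -/
def epsOpt (φ : 𝒳 → 𝒜 → Fin d → ℝ) (ε : ℝ) (θ : Fin d → ℝ) (x : 𝒳) : Set 𝒜 :=
  if ε = 0 then {a | gap φ θ x a = 0} else {a | gap φ θ x a < ε}

/-- Set `Λ` of allocations. -/
def Alloc (𝒳 𝒜 : Type*) [Fintype 𝒳] [Fintype 𝒜] : Set (𝒳 → 𝒜 → ℝ) :=
  {α | (∀ x a, 0 ≤ α x a ∧ α x a ≤ 1) ∧ ∀ x, ∑ a : 𝒜, α x a = 1}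

/-- Design matrix `A(α) = ∑_{x,a} p(x) α_{x,a} φ_{x,a} φ_{x,a}ᵀ`. -/
def Amat (p : 𝒳 → ℝ) (φ : 𝒳 → 𝒜 → Fin d → ℝ) (α : 𝒳 → 𝒜 → ℝ) :
    Matrix (Fin d) (Fin d) ℝ :=
  ∑ x : 𝒳, ∑ a : 𝒜, (p x * α x a) • vecMulVec (φ x a) (φ x a)

/-- Squared `G`-norm `‖v‖²_G = vᵀ G v`. -/
def normSq (G : Matrix (Fin d) (Fin d) ℝ) (v : Fin d → ℝ) : ℝ := v ⬝ᵥ G.mulVec v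

/-- Set of confusing parameters `B̄_ε(θ)`. -/
def Bbar (φ : 𝒳 → 𝒜 → Fin d → ℝ) (ε : ℝ) (θ : Fin d → ℝ) : Set (Fin d → ℝ) :=
  {μ | ∃ x a, a ∈ epsOpt φ ε θ x ∧ gap φ μ x a > ε}

/-- `ψ̄_{θ,ε}(α) = inf_{μ ∈ B̄_ε(θ)} ½‖θ − μ‖²_{A(α)}`. -/
def psiBar (p : 𝒳 → ℝ) (φ : 𝒳 → 𝒜 → Fin d → ℝ) (ε : ℝ) (θ : Fin d → ℝ)
    (α : 𝒳 → 𝒜 → ℝ) : ℝ :=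
  ⨅ μ : Bbar φ ε θ, (1 / 2) * normSq (Amat p φ α) (θ - μ.1)

/-- `ψ̄*_{θ,ε} = sup_{α ∈ Λ} ψ̄_{θ,ε}(α)`. -/
def psiStar (p : 𝒳 → ℝ) (φ : 𝒳 → 𝒜 → Fin d → ℝ) (ε : ℝ) (θ : Fin d → ℝ) : ℝ :=
  ⨆ α : Alloc 𝒳 𝒜, psiBar p φ ε θ α.1

/-- `C*_ε(θ) = argmax_{α ∈ Λ} ψ̄_{θ,ε}(α)`. -/
def Cstar (p : 𝒳 → ℝ) (φ : 𝒳 → 𝒜 → Fin d → ℝ) (ε : ℝ) (θ : Fin d → ℝ) :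
    Set (𝒳 → 𝒜 → ℝ) :=
  {α ∈ Alloc 𝒳 𝒜 | ∀ α' ∈ Alloc 𝒳 𝒜, psiBar p φ ε θ α' ≤ psiBar p φ ε θ α}

/-- Inner max in the definition of the (approximate) characteristic time, with the
convention that the maximum over an empty index set is `0`. -/
def Tinner (p : 𝒳 → ℝ) (φ : 𝒳 → 𝒜 → Fin d → ℝ) (ε : ℝ) (θ : Fin d → ℝ)
    (α : 𝒳 → 𝒜 → ℝ) : ℝ :=
  sSup ({0} ∪ {v | ∃ x a b, a ∉ epsOpt φ ε θ x ∧ b ∈ epsOpt φ ε θ x ∧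
      ε ≤ θ ⬝ᵥ (φ x b - φ x a) ∧
      v = 2 * normSq (Amat p φ α)⁻¹ (φ x b - φ x a) / (θ ⬝ᵥ (φ x b - φ x a) + ε) ^ 2})

/-- Approximate characteristic time `T*_{θ,ε}`. -/
def Tstar (p : 𝒳 → ℝ) (φ : 𝒳 → 𝒜 → Fin d → ℝ) (ε : ℝ) (θ : Fin d → ℝ) : ℝ :=
  sInf {v | ∃ α ∈ Alloc 𝒳 𝒜, IsUnit (Amat p φ α) ∧ v = Tinner p φ ε θ α}


lemma aux_normSq (p : 𝒳 → ℝ) (φ : 𝒳 → 𝒜 → Fin d → ℝ) (α : 𝒳 → 𝒜 → ℝ) (v : Fin d → ℝ) :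
    normSq (Amat p φ α) v = ∑ x, ∑ a, p x * α x a * (v ⬝ᵥ φ x a) ^ 2 := by
  unfold normSq Amat
  simp only [Matrix.sum_mulVec, dotProduct_sum, Matrix.smul_mulVec, dotProduct_smul,
    Matrix.vecMulVec_mulVec]
  refine Finset.sum_congr rfl fun x _ => Finset.sum_congr rfl fun a _ => ?_
  simp [dotProduct_comm (φ x a) v]
  ring_nf
  simp

lemma aux_normSq_nonneg (p : 𝒳 → ℝ) (hp : ∀ x, 0 < p x) (φ : 𝒳 → 𝒜 → Fin d → ℝ)
    (α : 𝒳 → 𝒜 → ℝ) (hα : α ∈ Alloc 𝒳 𝒜) (v : Fin d → ℝ) :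
    0 ≤ normSq (Amat p φ α) v := by
  rw [aux_normSq]
  exact Finset.sum_nonneg fun x _ => Finset.sum_nonneg fun a _ =>
    mul_nonneg (mul_nonneg (hp x).le (hα.1 x a).1) (sq_nonneg _)

lemma aux_term_le (p : 𝒳 → ℝ) (hp : ∀ x, 0 < p x) (φ : 𝒳 → 𝒜 → Fin d → ℝ)
    (α : 𝒳 → 𝒜 → ℝ) (hα : α ∈ Alloc 𝒳 𝒜) (v : Fin d → ℝ) (x : 𝒳) (a : 𝒜) :
    p x * α x a * (v ⬝ᵥ φ x a) ^ 2 ≤ normSq (Amat p φ α) v := by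
  rw [aux_normSq]
  have h0 : ∀ x a, 0 ≤ p x * α x a * (v ⬝ᵥ φ x a) ^ 2 := fun x a =>
    mul_nonneg (mul_nonneg (hp x).le (hα.1 x a).1) (sq_nonneg _)
  calc _ ≤ ∑ a, p x * α x a * (v ⬝ᵥ φ x a) ^ 2 :=
        Finset.single_le_sum (f := fun a => p x * α x a * (v ⬝ᵥ φ x a) ^ 2)
          (fun a _ => h0 x a) (Finset.mem_univ a)
    _ ≤ _ := Finset.single_le_sum (f := fun x => ∑ a, p x * α x a * (v ⬝ᵥ φ x a) ^ 2)
          (fun x _ => Finset.sum_nonneg fun a _ => h0 x a) (Finset.mem_univ x)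

lemma aux_bdd (p : 𝒳 → ℝ) (hp : ∀ x, 0 < p x) (φ : 𝒳 → 𝒜 → Fin d → ℝ) (ε : ℝ)
    (θ : Fin d → ℝ) (α : 𝒳 → 𝒜 → ℝ) (hα : α ∈ Alloc 𝒳 𝒜) :
    BddBelow (Set.range fun μ : Bbar φ ε θ => (1 / 2) * normSq (Amat p φ α) (θ - μ.1)) := by
  refine ⟨0, ?_⟩
  rintro _ ⟨μ, rfl⟩
  have := aux_normSq_nonneg p hp φ α hα (θ - μ.1)
  simp only
  linarith

lemma aux_maxVal_ge (φ : 𝒳 → 𝒜 → Fin d → ℝ) (θ : Fin d → ℝ) (x : 𝒳) (a : 𝒜) :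
    θ ⬝ᵥ φ x a ≤ maxVal φ θ x :=
  le_ciSup (f := fun a => θ ⬝ᵥ φ x a) (Set.finite_range _).bddAbove a

lemma aux_maxVal_eq (φ : 𝒳 → 𝒜 → Fin d → ℝ) (θ : Fin d → ℝ) (x : 𝒳) :
    ∃ a, θ ⬝ᵥ φ x a = maxVal φ θ x :=
  exists_eq_ciSup_of_finite (f := fun a => θ ⬝ᵥ φ x a)

lemma aux_epsOpt (φ : 𝒳 → 𝒜 → Fin d → ℝ) (ε : ℝ) (hε : 0 < ε) (θ : Fin d → ℝ) (x : 𝒳) (a : 𝒜) :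
    a ∈ epsOpt φ ε θ x ↔ gap φ θ x a < ε := by
  simp [epsOpt, hε.ne']

lemma aux_compact : IsCompact (Alloc 𝒳 𝒜) := by
  have hK : IsCompact (Set.pi Set.univ fun _ : 𝒳 => Set.pi Set.univ fun _ : 𝒜 =>
      Set.Icc (0:ℝ) 1) :=
    isCompact_univ_pi fun _ => isCompact_univ_pi fun _ => isCompact_Icc
  refine hK.of_isClosed_subset ?_ ?_
  · have : Alloc 𝒳 𝒜 = (⋂ x, ⋂ a, {α : 𝒳 → 𝒜 → ℝ | 0 ≤ α x a ∧ α x a ≤ 1}) ∩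
        ⋂ x, {α : 𝒳 → 𝒜 → ℝ | ∑ a : 𝒜, α x a = 1} := by
      ext α; simp [Alloc]
    rw [this]
    refine IsClosed.inter (isClosed_iInter fun x => isClosed_iInter fun a => ?_)
      (isClosed_iInter fun x => ?_)
    · have hc : Continuous fun α : 𝒳 → 𝒜 → ℝ => α x a := by fun_prop
      exact (isClosed_le continuous_const hc).inter (isClosed_le hc continuous_const)
    · exact isClosed_eq (by fun_prop) (by fun_prop)
  · intro α hα x _ a _
    exact hα.1 x a

lemma aux_exists_max [Nonempty 𝒳] (p : 𝒳 → ℝ) (hp : ∀ x, 0 < p x) (φ : 𝒳 → 𝒜 → Fin d → ℝ)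
    (ε : ℝ) (θ : Fin d → ℝ) (hne : (Alloc 𝒳 𝒜).Nonempty) : ∃ α, α ∈ Cstar p φ ε θ := by
  have husc : UpperSemicontinuousOn (psiBar p φ ε θ) (Alloc 𝒳 𝒜) := by
    unfold psiBar
    refine upperSemicontinuousOn_ciInf (fun α hα => aux_bdd p hp φ ε θ α hα) fun μ => ?_
    apply ContinuousOn.upperSemicontinuousOn
    simp only [aux_normSq]
    fun_prop
  obtain ⟨α, hα, hmax⟩ := husc.exists_isMaxOn hne aux_compact
  exact ⟨α, hα, fun α' h => hmax h⟩

lemma aux_unif [Nonempty 𝒳] : (fun _ _ => (Fintype.card 𝒜 : ℝ)⁻¹) ∈ Alloc 𝒳 𝒜 := by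
  have h1 : (1:ℝ) ≤ Fintype.card 𝒜 := by exact_mod_cast Fintype.card_pos
  refine ⟨fun x a => ⟨by positivity, inv_le_one_of_one_le₀ h1⟩, fun x => ?_⟩
  simp

lemma aux_pos [Nonempty 𝒳] (p : 𝒳 → ℝ) (hp : ∀ x, 0 < p x) (φ : 𝒳 → 𝒜 → Fin d → ℝ)
    (ε : ℝ) (hε : 0 < ε) (θ : Fin d → ℝ) (hB : (Bbar φ ε θ).Nonempty) :
    0 < psiBar p φ ε θ (fun _ _ => (Fintype.card 𝒜 : ℝ)⁻¹) := by
  classical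
  have hN : (0:ℝ) < (Fintype.card 𝒜 : ℝ)⁻¹ := by
    have : (0:ℝ) < Fintype.card 𝒜 := by exact_mod_cast Fintype.card_pos
    positivity
  obtain ⟨x0, hx0⟩ := Finite.exists_min p
  obtain ⟨y0, hy0⟩ := Finite.exists_min
    (fun y : 𝒳 × 𝒜 => if gap φ θ y.1 y.2 < ε then ε - gap φ θ y.1 y.2 else 1)
  set δ := (if gap φ θ y0.1 y0.2 < ε then ε - gap φ θ y0.1 y0.2 else 1) with hδ
  have hδ0 : 0 < δ := by
    rw [hδ]; split_ifs <;> linarith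
  have hδ1 : ∀ x a, gap φ θ x a < ε → δ ≤ ε - gap φ θ x a := by
    intro x a h
    have := hy0 (x, a)
    simp only [h, if_true] at this
    exact this
  set c := p x0 * (Fintype.card 𝒜 : ℝ)⁻¹ with hc
  have hc0 : 0 < c := mul_pos (hp x0) hN
  have : Nonempty (Bbar φ ε θ) := hB.to_subtype
  refine lt_of_lt_of_le (show 0 < c * δ ^ 2 / 8 by positivity) (le_ciInf ?_)
  rintro ⟨μ, x, a, ha, hg⟩
  rw [aux_epsOpt φ ε hε] at ha
  have hd := hδ1 x a ha
  obtain ⟨b, hb⟩ := aux_maxVal_eq φ μ x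
  have hb' := aux_maxVal_ge φ θ x b
  have key : ∀ a', c * ((θ - μ) ⬝ᵥ φ x a') ^ 2 ≤
      normSq (Amat p φ (fun _ _ => (Fintype.card 𝒜 : ℝ)⁻¹)) (θ - μ) := fun a' =>
    le_trans (mul_le_mul_of_nonneg_right (mul_le_mul_of_nonneg_right (hx0 x) hN.le)
      (sq_nonneg _)) (aux_term_le p hp φ _ aux_unif (θ - μ) x a')
  have k1 := key a
  have k2 := key b
  unfold gap at hg hd
  have h3 : δ ≤ (θ - μ) ⬝ᵥ φ x a - (θ - μ) ⬝ᵥ φ x b := by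
    simp only [sub_dotProduct]; linarith
  generalize (θ - μ) ⬝ᵥ φ x a = u at *
  generalize (θ - μ) ⬝ᵥ φ x b = w at *
  have h4 : δ ^ 2 ≤ 2 * u ^ 2 + 2 * w ^ 2 := by nlinarith [sq_nonneg (u + w)]
  have h5 := mul_le_mul_of_nonneg_left h4 hc0.le
  simp only
  nlinarith

lemma aux_ker [Nonempty 𝒳] (p : 𝒳 → ℝ) (hp : ∀ x, 0 < p x) (φ : 𝒳 → 𝒜 → Fin d → ℝ)
    (hspan : Submodule.span ℝ {v : Fin d → ℝ | ∃ x a, v = φ x a} = ⊤)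
    (ε : ℝ) (hε : 0 < ε) (θ : Fin d → ℝ) (α : 𝒳 → 𝒜 → ℝ) (hα : α ∈ Alloc 𝒳 𝒜)
    (hpos : 0 < psiBar p φ ε θ α) (v : Fin d → ℝ) (hv : normSq (Amat p φ α) v = 0) : v = 0 := by
  have hzero : ∀ x a, α x a ≠ 0 → v ⬝ᵥ φ x a = 0 := by
    intro x a h
    have h1 := aux_term_le p hp φ α hα v x a
    have h2 : 0 < p x * α x a := mul_pos (hp x) (lt_of_le_of_ne (hα.1 x a).1 h.symm)
    rw [hv] at h1
    have h3 : (v ⬝ᵥ φ x a) ^ 2 ≤ 0 := by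
      by_contra hcon
      push Not at hcon
      nlinarith [mul_pos h2 hcon]
    exact pow_eq_zero_iff (two_ne_zero) |>.1 (le_antisymm h3 (sq_nonneg _))
  have hconst : ∀ x a b, θ ⬝ᵥ φ x a = maxVal φ θ x → v ⬝ᵥ φ x b = v ⬝ᵥ φ x a := by
    intro x a b ha
    by_contra hne
    have hne' : v ⬝ᵥ φ x b - v ⬝ᵥ φ x a ≠ 0 := sub_ne_zero.2 hne
    set D := v ⬝ᵥ φ x b - v ⬝ᵥ φ x a with hD
    set t := (ε + 1 + (θ ⬝ᵥ φ x a - θ ⬝ᵥ φ x b)) / D with ht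
    have htD : t * D = ε + 1 + (θ ⬝ᵥ φ x a - θ ⬝ᵥ φ x b) := div_mul_cancel₀ _ hne'
    have hmem : θ + t • v ∈ Bbar φ ε θ := by
      refine ⟨x, a, ?_, ?_⟩
      · rw [aux_epsOpt φ ε hε, gap, ha]; simpa using hε
      · have := aux_maxVal_ge φ (θ + t • v) x b
        unfold gap
        simp only [add_dotProduct, smul_dotProduct, smul_eq_mul] at this ⊢
        rw [hD] at htD
        nlinarith
    have hle : psiBar p φ ε θ α ≤ _ := ciInf_le (aux_bdd p hp φ ε θ α hα) ⟨θ + t • v, hmem⟩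
    have h0 : normSq (Amat p φ α) (θ - (θ + t • v)) = 0 := by
      have : θ - (θ + t • v) = (-t) • v := by simp
      rw [this]
      unfold normSq at hv ⊢
      rw [Matrix.mulVec_smul, smul_dotProduct, dotProduct_smul, hv]; simp
    simp only [h0] at hle
    linarith
  have hall : ∀ x b, v ⬝ᵥ φ x b = 0 := by
    intro x b
    obtain ⟨a, ha⟩ := aux_maxVal_eq φ θ x
    obtain ⟨a', -, ha'⟩ : ∃ a' ∈ Finset.univ, α x a' ≠ 0 := by
      apply Finset.exists_ne_zero_of_sum_ne_zero
      rw [hα.2 x]; exact one_ne_zero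
    rw [hconst x a b ha, ← hconst x a a' ha, hzero x a' ha']
  have htop : ∀ w : Fin d → ℝ, v ⬝ᵥ w = 0 := by
    intro w
    have hw : w ∈ Submodule.span ℝ {v : Fin d → ℝ | ∃ x a, v = φ x a} := by rw [hspan]; trivial
    induction hw using Submodule.span_induction with
    | mem w h => obtain ⟨x, a, rfl⟩ := h; exact hall x a
    | zero => simp
    | add y z _ _ h1 h2 => rw [dotProduct_add, h1, h2, add_zero]
    | smul r y _ h => rw [dotProduct_smul, h, smul_zero]
  exact dotProduct_self_eq_zero.1 (htop v)

/-- `C*_ε(θ)` is nonempty and contains an allocation `α*` with `A(α*)` positive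
definite, assuming the features span `ℝ^d`, `p > 0`, and `B̄_ε(θ)` is nonempty. -/
theorem stmt_8 [Nonempty 𝒳] (φ : 𝒳 → 𝒜 → Fin d → ℝ)
    (hspan : Submodule.span ℝ {v : Fin d → ℝ | ∃ x a, v = φ x a} = ⊤)
    (p : 𝒳 → ℝ) (hp : ∀ x, 0 < p x) (hpsum : ∑ x : 𝒳, p x = 1)
    (ε : ℝ) (hε : 0 < ε) (θ : Fin d → ℝ) (hB : (Bbar φ ε θ).Nonempty) :
    ∃ α ∈ Cstar p φ ε θ, (Amat p φ α).PosDef := by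
  obtain ⟨α, hα⟩ := aux_exists_max p hp φ ε θ ⟨_, aux_unif⟩
  have hpos : 0 < psiBar p φ ε θ α :=
    lt_of_lt_of_le (aux_pos p hp φ ε hε θ hB) (hα.2 _ aux_unif)
  refine ⟨α, hα, Matrix.PosDef.of_dotProduct_mulVec_pos ?_ ?_⟩
  · ext i j
    simp [Amat, Matrix.sum_apply, Matrix.vecMulVec_apply, mul_comm]
  · intro v hv
    have h0 := aux_normSq_nonneg p hp φ α hα.1 v
    have h1 : normSq (Amat p φ α) v ≠ 0 := fun h =>
      hv (aux_ker p hp φ hspan ε hε θ α hα.1 hpos v h)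
    have h2 := lt_of_le_of_ne h0 h1.symm
    simpa [normSq] using h2

end
end

section
/- In the sequential linear model, let L = max_{φ∈Φ} ‖φ‖ and suppose there exist t₀ ≥ 1, c > 0 and a ∈ (0,1) such that λ_min(A_t) ≥ c t^a almost surely for all t ≥ t₀. Then for all t ≥ t₀ and all ε > 0, ℙ( ‖θ̂_t − θ‖ ≥ ε ) ≤ (c^{−1/2} L)^d · t^{(1−a)d/2} · exp( −c ε² t^a / 4 ). -/
open MeasureTheory ProbabilityTheory Matrix Filter

noncomputable section

/-- Smallest eigenvalue of a (symmetric) matrix, characterized as the infimum of the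
quadratic form over the Euclidean unit sphere. -/
def lambdaMin {d : ℕ} (A : Matrix (Fin d) (Fin d) ℝ) : ℝ :=
  ⨅ v : {v : Fin d → ℝ // ∑ i, v i ^ 2 = 1}, v.1 ⬝ᵥ A.mulVec v.1

/-- Euclidean norm on `ℝ^d`. -/
def euclNorm {d : ℕ} (v : Fin d → ℝ) : ℝ := Real.sqrt (∑ i, v i ^ 2)


lemma aux_chain {Ω : Type*} [MeasureSpace Ω] [IsProbabilityMeasure (ℙ : Measure Ω)]
    {E F : Type*} [MeasurableSpace E] [MeasurableSpace F]
    (ξ : ℕ → Ω → ℝ) (φ : ℕ → Ω → F)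
    (hξmeas : ∀ s, Measurable (ξ s)) (hφmeas : ∀ s, Measurable (φ s))
    (hgauss : ∀ s, Measure.map (ξ s) ℙ = gaussianReal 0 1)
    (hindep : ∀ s, Indep (MeasurableSpace.comap (ξ s) inferInstance)
      ((⨆ i ∈ Finset.range (s + 1), MeasurableSpace.comap (φ i) inferInstance) ⊔
       (⨆ i ∈ Finset.range s, MeasurableSpace.comap (ξ i) inferInstance)) ℙ)
    (Z : ℕ → Ω → E) (step : E → F → ℝ → E)
    (hstepm : Measurable (fun p : (E × F) × ℝ => step p.1.1 p.1.2 p.2))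
    (z0 : E) (hZ0 : ∀ ω, Z 0 ω = z0)
    (hZ : ∀ s ω, Z (s + 1) ω = step (Z s ω) (φ s ω) (ξ s ω))
    (H : E → ENNReal) (hH : Measurable H) (t : ℕ)
    (hstep : ∀ s < t, ∀ ω, ∫⁻ x, H (step (Z s ω) (φ s ω) x) ∂(gaussianReal 0 1) ≤ H (Z s ω)) :
    ∫⁻ ω, H (Z t ω) ∂ℙ ≤ H z0 := by
  have hmZ : ∀ s, @Measurable Ω E
      ((⨆ i ∈ Finset.range s, MeasurableSpace.comap (φ i) inferInstance) ⊔
       (⨆ i ∈ Finset.range s, MeasurableSpace.comap (ξ i) inferInstance)) _ (Z s) := by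
    intro s
    induction s with
    | zero =>
      have : Z 0 = fun _ => z0 := funext hZ0
      rw [this]
      exact @measurable_const _ _ _ (_) _
    | succ s ih =>
      have h1 : Z (s + 1) = (fun p : (E × F) × ℝ => step p.1.1 p.1.2 p.2) ∘
          (fun ω => ((Z s ω, φ s ω), ξ s ω)) := funext (hZ s)
      rw [h1]
      refine hstepm.comp ?_
      refine Measurable.prodMk (Measurable.prodMk (ih.mono ?_ le_rfl) ?_) ?_
      · refine sup_le_sup ?_ ?_ <;>
        exact biSup_mono (fun i hi => Finset.range_subset_range.2 (Nat.le_succ s) hi)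
      · refine Measurable.mono (comap_measurable (φ s)) (le_trans ?_ le_sup_left) le_rfl
        exact le_biSup (fun i => MeasurableSpace.comap (φ i) inferInstance)
          (Finset.self_mem_range_succ s)
      · refine Measurable.mono (comap_measurable (ξ s)) (le_trans ?_ le_sup_right) le_rfl
        exact le_biSup (fun i => MeasurableSpace.comap (ξ i) inferInstance)
          (Finset.self_mem_range_succ s)
  have hle : ∀ s, ((⨆ i ∈ Finset.range (s+1), MeasurableSpace.comap (φ i) inferInstance) ⊔
       (⨆ i ∈ Finset.range s, MeasurableSpace.comap (ξ i) inferInstance)) ≤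
       (inferInstance : MeasurableSpace Ω) := by
    intro s
    refine sup_le ?_ ?_
    · exact iSup₂_le (fun i _ => (hφmeas i).comap_le)
    · exact iSup₂_le (fun i _ => (hξmeas i).comap_le)
  have hpair : ∀ s, @Measurable Ω (E × F)
      ((⨆ i ∈ Finset.range (s+1), MeasurableSpace.comap (φ i) inferInstance) ⊔
       (⨆ i ∈ Finset.range s, MeasurableSpace.comap (ξ i) inferInstance)) _
       (fun ω => (Z s ω, φ s ω)) := by
    intro s
    refine Measurable.prodMk ((hmZ s).mono ?_ le_rfl) ?_
    · refine sup_le_sup ?_ le_rfl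
      exact biSup_mono (fun i hi => Finset.range_subset_range.2 (Nat.le_succ s) hi)
    · refine Measurable.mono (comap_measurable (φ s)) (le_trans ?_ le_sup_left) le_rfl
      exact le_biSup (fun i => MeasurableSpace.comap (φ i) inferInstance)
          (Finset.self_mem_range_succ s)
  have key : ∀ s ≤ t, ∫⁻ ω, H (Z s ω) ∂ℙ ≤ H z0 := by
    intro s
    induction s with
    | zero => intro _; simp [hZ0]
    | succ s ih =>
      intro hs
      refine le_trans ?_ (ih (by omega))
      have hp : Measurable (fun ω => (Z s ω, φ s ω)) := (hpair s).mono (hle s) le_rfl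
      have hind : IndepFun (fun ω => (Z s ω, φ s ω)) (ξ s) ℙ := by
        rw [IndepFun_iff_Indep]
        refine Indep.symm ?_
        exact indep_of_indep_of_le_right (hindep s) (hpair s).comap_le
      have hmap := (indepFun_iff_map_prod_eq_prod_map_map hp.aemeasurable
        (hξmeas s).aemeasurable).1 hind
      have hG : Measurable (fun p : (E × F) × ℝ => H (step p.1.1 p.1.2 p.2)) := hH.comp hstepm
      calc ∫⁻ ω, H (Z (s+1) ω) ∂ℙ
          = ∫⁻ ω, (fun p : (E × F) × ℝ => H (step p.1.1 p.1.2 p.2)) ((Z s ω, φ s ω), ξ s ω) ∂ℙ := by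
            simp only [hZ]
        _ = ∫⁻ p, (fun p : (E × F) × ℝ => H (step p.1.1 p.1.2 p.2)) p
              ∂(Measure.map (fun ω => ((Z s ω, φ s ω), ξ s ω)) ℙ) := by
            rw [lintegral_map hG (hp.prodMk (hξmeas s))]
        _ = ∫⁻ q, ∫⁻ x, H (step q.1 q.2 x) ∂(gaussianReal 0 1)
              ∂(Measure.map (fun ω => (Z s ω, φ s ω)) ℙ) := by
            rw [hmap, hgauss, lintegral_prod _ hG.aemeasurable]
        _ = ∫⁻ ω, ∫⁻ x, H (step (Z s ω) (φ s ω) x) ∂(gaussianReal 0 1) ∂ℙ := by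
            rw [lintegral_map hG.lintegral_prod_right' hp]
        _ ≤ _ := lintegral_mono (hstep s (by omega))
  exact key t le_rfl

/-- Exponential tilting of the standard Gaussian. -/
lemma aux_tilt (al be : ℝ) (hal : 0 < 1 + al) (x : ℝ) :
    gaussianPDFReal 0 1 x * Real.exp (-(al * x ^ 2) / 2 + be * x) =
      (1 / √(1 + al) * Real.exp (be ^ 2 / (2 * (1 + al)))) *
        gaussianPDFReal (be / (1 + al)) (Real.toNNReal (1 / (1 + al))) x := by
  have hp : 0 < 1 / (1 + al) := by positivity
  unfold gaussianPDFReal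
  rw [Real.coe_toNNReal _ hp.le]
  have e1 : √(2 * Real.pi * (1 / (1 + al))) = √(2 * Real.pi) / √(1 + al) := by
    rw [mul_one_div, Real.sqrt_div (by positivity)]
  have h2 : 0 < √(1 + al) := Real.sqrt_pos.2 hal
  have h3 : 0 < √(2 * Real.pi) := Real.sqrt_pos.2 (by positivity)
  rw [e1]
  have e2 : Real.exp (-(x - 0) ^ 2 / (2 * ((1 : NNReal) : ℝ))) * Real.exp (-(al * x ^ 2) / 2 + be * x)
     = Real.exp (be ^ 2 / (2 * (1 + al))) *
      Real.exp (-(x - be / (1 + al)) ^ 2 / (2 * (1 / (1 + al)))) := by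
    rw [← Real.exp_add, ← Real.exp_add]
    congr 1
    push_cast
    field_simp
    ring
  rw [mul_assoc, e2]
  simp only [NNReal.coe_one, mul_one]
  field_simp

lemma aux_tilt_integral (al be : ℝ) (hal : 0 < 1 + al) (g : ℝ → ℝ) :
    ∫ x, Real.exp (-(al * x ^ 2) / 2 + be * x) * g x ∂(gaussianReal 0 1) =
      (1 / √(1 + al) * Real.exp (be ^ 2 / (2 * (1 + al)))) *
        ∫ x, g x ∂(gaussianReal (be / (1 + al)) (Real.toNNReal (1 / (1 + al)))) := by
  have hp : 0 < 1 / (1 + al) := by positivity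
  rw [integral_gaussianReal_eq_integral_smul one_ne_zero,
    integral_gaussianReal_eq_integral_smul (by simpa using hal), ← integral_const_mul]
  congr 1
  ext x
  simp only [smul_eq_mul]
  rw [← mul_assoc, aux_tilt al be hal, mul_assoc]

lemma aux_tilt_lintegral (al be : ℝ) (hal : 0 < 1 + al) :
    ∫⁻ x, ENNReal.ofReal (Real.exp (-(al * x ^ 2) / 2 + be * x)) ∂(gaussianReal 0 1) =
      ENNReal.ofReal (1 / √(1 + al) * Real.exp (be ^ 2 / (2 * (1 + al)))) := by
  have hp : 0 < 1 / (1 + al) := by positivity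
  rw [gaussianReal_of_var_ne_zero _ one_ne_zero,
    lintegral_withDensity_eq_lintegral_mul _ (measurable_gaussianPDF _ _) (by fun_prop)]
  have : ∀ x, (gaussianPDF 0 1 * fun x => ENNReal.ofReal
      (Real.exp (-(al * x ^ 2) / 2 + be * x))) x =
      ENNReal.ofReal (1 / √(1 + al) * Real.exp (be ^ 2 / (2 * (1 + al)))) *
        gaussianPDF (be / (1 + al)) (Real.toNNReal (1 / (1 + al))) x := by
    intro x
    simp only [Pi.mul_apply, gaussianPDF]
    rw [← ENNReal.ofReal_mul (gaussianPDFReal_nonneg _ _ _), aux_tilt al be hal,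
      ENNReal.ofReal_mul (by positivity)]
  simp_rw [this]
  rw [lintegral_const_mul _ (measurable_gaussianPDF _ _), lintegral_gaussianPDF_eq_one, mul_one]
  simpa using hal

lemma aux_sq_gauss (m : ℝ) (v : NNReal) : ∫ x, x ^ 2 ∂(gaussianReal m v) = v + m ^ 2 := by
  have h := variance_eq_sub (μ := gaussianReal m v) (X := id) (memLp_id_gaussianReal 2)
  rw [variance_id_gaussianReal] at h
  simp only [id_eq, integral_id_gaussianReal, Pi.pow_apply] at h
  linarith

lemma aux_markov {Ω : Type*} [MeasureSpace Ω] [IsProbabilityMeasure (ℙ : Measure Ω)]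
    (f : Ω → ENNReal) (hf : Measurable f) (Ev : Set Ω) (c K : ℝ) (hc : 0 < c)
    (hae : ∀ᵐ ω ∂ℙ, ω ∈ Ev → ENNReal.ofReal c ≤ f ω)
    (hK : ∫⁻ ω, f ω ∂ℙ ≤ ENNReal.ofReal K) : ℙ Ev ≤ ENNReal.ofReal (K / c) := by
  have h1 : ℙ Ev ≤ ℙ {ω | ENNReal.ofReal c ≤ f ω} := measure_mono_ae hae
  have h2 := mul_meas_ge_le_lintegral hf (ENNReal.ofReal c) (μ := ℙ)
  rw [ENNReal.ofReal_div_of_pos hc]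
  rw [ENNReal.le_div_iff_mul_le (Or.inl (by simpa using hc)) (Or.inl ENNReal.ofReal_ne_top), mul_comm]
  exact (mul_le_mul_right h1 _).trans (h2.trans hK)

/-- The bump functional. -/
def bumpP (y κ B S : ℝ) : ℝ :=
  1 / √B * (Real.exp (-S ^ 2 / (2 * B)) * (κ + y / B - y * S ^ 2 / B ^ 2))

lemma aux_bump_integrable (y κ B S f : ℝ) (hB : 0 < B) :
    Integrable (fun x => bumpP y κ B (S + f * x)) (gaussianReal 0 1) := by
  unfold bumpP
  refine Integrable.const_mul ?_ _
  have i1 : Integrable (fun x : ℝ => x) (gaussianReal 0 1) :=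
    (memLp_id_gaussianReal 1).integrable (by simp)
  have i2 : Integrable (fun x : ℝ => x ^ 2) (gaussianReal 0 1) :=
    (memLp_id_gaussianReal (μ := 0) (v := 1) 2).integrable_sq
  have i3 : Integrable (fun x : ℝ => κ + y / B - y * (S + f * x) ^ 2 / B ^ 2) (gaussianReal 0 1) := by
    have : (fun x : ℝ => κ + y / B - y * (S + f * x) ^ 2 / B ^ 2) =
      fun x => (κ + y / B - y * S ^ 2 / B ^ 2) + ((- (2 * y * S * f / B ^ 2)) * x
        + (- (y * f ^ 2 / B ^ 2)) * x ^ 2) := by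
      ext x; field_simp; ring
    rw [this]
    exact (integrable_const _).add ((i1.const_mul _).add (i2.const_mul _))
  refine i3.bdd_mul (c := 1) (by fun_prop) (ae_of_all _ fun x => ?_)
  rw [Real.norm_eq_abs, abs_of_pos (Real.exp_pos _), Real.exp_le_one_iff]
  have : 0 ≤ (S + f * x) ^ 2 / (2 * B) := by positivity
  rw [neg_div]; linarith

lemma aux_bump_step (y κ B S f : ℝ) (hB : 0 < B - f ^ 2) :
    ∫ x, bumpP y κ (B - f ^ 2) (S + f * x) ∂(gaussianReal 0 1) = bumpP y κ B S := by
  set B' := B - f ^ 2 with hB'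
  have hBB : B = B' + f ^ 2 := by rw [hB']; ring
  have hBpos : 0 < B := by rw [hBB]; positivity
  have hal : 0 < 1 + f ^ 2 / B' := by positivity
  have hal' : 1 + f ^ 2 / B' = B / B' := by rw [hBB]; field_simp
  have e0 : ∀ x, bumpP y κ B' (S + f * x) = (1 / √B' * Real.exp (- S ^ 2 / (2 * B'))) *
     (Real.exp (-((f ^ 2 / B') * x ^ 2) / 2 + (- (S * f / B')) * x) *
      (κ + y / B' - y * (S + f * x) ^ 2 / B' ^ 2)) := by
    intro x
    unfold bumpP
    have : Real.exp (-(S + f * x) ^ 2 / (2 * B')) = Real.exp (- S ^ 2 / (2 * B')) *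
      Real.exp (-((f ^ 2 / B') * x ^ 2) / 2 + (- (S * f / B')) * x) := by
      rw [← Real.exp_add]; congr 1; field_simp; ring
    rw [this]; ring
  simp_rw [e0]
  rw [integral_const_mul, aux_tilt_integral _ _ hal, hal']
  have hv : ((Real.toNNReal (1 / (B / B')) : NNReal) : ℝ) = B' / B := by
    rw [Real.coe_toNNReal _ (by positivity)]; field_simp
  generalize hV : Real.toNNReal (1 / (B / B')) = v at hv
  generalize hM : -(S * f / B') / (B / B') = m
  have hm : m = - (S * f / B) := by rw [← hM]; field_simp
  have i1 : Integrable (fun x : ℝ => x) (gaussianReal m v) :=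
    (memLp_id_gaussianReal 1).integrable (by simp)
  have i2 : Integrable (fun x : ℝ => x ^ 2) (gaussianReal m v) :=
    (memLp_id_gaussianReal (μ := m) (v := v) 2).integrable_sq
  have e1 : ∫ x, (κ + y / B' - y * (S + f * x) ^ 2 / B' ^ 2) ∂(gaussianReal m v) =
      (κ + y / B' - y * S ^ 2 / B' ^ 2) + ((- (2 * y * S * f / B' ^ 2)) * m
        + (- (y * f ^ 2 / B' ^ 2)) * (v + m ^ 2)) := by
    have : (fun x : ℝ => κ + y / B' - y * (S + f * x) ^ 2 / B' ^ 2) =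
      fun x => (κ + y / B' - y * S ^ 2 / B' ^ 2) + ((- (2 * y * S * f / B' ^ 2)) * x
        + (- (y * f ^ 2 / B' ^ 2)) * x ^ 2) := by
      ext x; field_simp; ring
    have i12 : Integrable (fun x : ℝ => (- (2 * y * S * f / B' ^ 2)) * x
        + (- (y * f ^ 2 / B' ^ 2)) * x ^ 2) (gaussianReal m v) :=
      (i1.const_mul _).add (i2.const_mul _)
    rw [this, integral_add (integrable_const _) i12,
      integral_add (i1.const_mul _) (i2.const_mul _), integral_const_mul, integral_const_mul,
      integral_id_gaussianReal, aux_sq_gauss]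
    simp
  rw [e1, hm, hv]
  unfold bumpP
  have e2 : Real.exp (-S ^ 2 / (2 * B)) = Real.exp (- S ^ 2 / (2 * B')) *
      Real.exp ((-(S * f / B')) ^ 2 / (2 * (B / B'))) := by
    rw [← Real.exp_add]; congr 1
    field_simp
    rw [hBB]; ring
  have e3 : κ + y / B' - y * S ^ 2 / B' ^ 2 +
      (-(2 * y * S * f / B' ^ 2) * -(S * f / B) +
        -(y * f ^ 2 / B' ^ 2) * (B' / B + (-(S * f / B)) ^ 2)) = κ + y / B - y * S ^ 2 / B ^ 2 := by
    have hf : f ^ 2 = B - B' := by rw [hBB]; ring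
    field_simp
    rw [hf]; ring
  rw [e3, e2, Real.sqrt_div hBpos.le]
  have h2 : 0 < √B := Real.sqrt_pos.2 hBpos
  have h3 : 0 < √B' := Real.sqrt_pos.2 hB
  field_simp

section onedim
variable {Ω : Type*} [MeasureSpace Ω] [IsProbabilityMeasure (ℙ : Measure Ω)]
    {F : Type*} [MeasurableSpace F]

lemma aux_cosh
    (ξ : ℕ → Ω → ℝ) (φ : ℕ → Ω → F) (g : F → ℝ) (hg : Measurable g)
    (hξmeas : ∀ s, Measurable (ξ s)) (hφmeas : ∀ s, Measurable (φ s))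
    (hgauss : ∀ s, Measure.map (ξ s) ℙ = gaussianReal 0 1)
    (hindep : ∀ s, Indep (MeasurableSpace.comap (ξ s) inferInstance)
      ((⨆ i ∈ Finset.range (s + 1), MeasurableSpace.comap (φ i) inferInstance) ⊔
       (⨆ i ∈ Finset.range s, MeasurableSpace.comap (ξ i) inferInstance)) ℙ)
    (A S : ℕ → Ω → ℝ) (hA : ∀ t ω, A t ω = ∑ s ∈ Finset.range t, g (φ s ω) ^ 2)
    (hS : ∀ t ω, S t ω = ∑ s ∈ Finset.range t, g (φ s ω) * ξ s ω)
    (t : ℕ) (hA1 : ∀ᵐ ω ∂ℙ, 1 ≤ A t ω) (y : ℝ) (hy : 0 ≤ y) :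
    ℙ {ω | y * A t ω ^ 2 ≤ S t ω ^ 2} ≤ ENNReal.ofReal (2 * Real.exp (-y / 2)) := by
  set b := √y with hb
  have hb2 : b ^ 2 = y := Real.sq_sqrt hy
  have hb0 : 0 ≤ b := Real.sqrt_nonneg y
  let H : ℝ × ℝ → ENNReal := fun z =>
    ENNReal.ofReal (Real.exp (b * z.2 - b ^ 2 * z.1 / 2)) +
    ENNReal.ofReal (Real.exp (-b * z.2 - b ^ 2 * z.1 / 2))
  have hH : Measurable H := by fun_prop
  have hch := aux_chain ξ φ hξmeas hφmeas hgauss hindep (fun t ω => (A t ω, S t ω))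
    (fun z f x => (z.1 + g f ^ 2, z.2 + g f * x)) (by fun_prop) (0, 0)
    (by intro ω; simp [hA, hS])
    (by intro s ω; simp [hA, hS, Finset.sum_range_succ])
    H hH t (by
      intro s _ ω
      simp only [H]
      generalize A s ω = A0
      generalize S s ω = S0
      generalize g (φ s ω) = f
      have aux : ∀ b : ℝ, ∫⁻ x, ENNReal.ofReal (Real.exp (b * (S0 + f * x)
          - b ^ 2 * (A0 + f ^ 2) / 2)) ∂(gaussianReal 0 1) =
          ENNReal.ofReal (Real.exp (b * S0 - b ^ 2 * A0 / 2)) := by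
        intro b
        have e : ∀ x, ENNReal.ofReal (Real.exp (b * (S0 + f * x) - b ^ 2 * (A0 + f ^ 2) / 2)) =
          ENNReal.ofReal (Real.exp (b * S0 - b ^ 2 * (A0 + f ^ 2) / 2)) *
          ENNReal.ofReal (Real.exp (-(0 * x ^ 2) / 2 + (b * f) * x)) := by
          intro x
          rw [← ENNReal.ofReal_mul (Real.exp_pos _).le, ← Real.exp_add]
          congr 2; ring
        simp_rw [e]
        rw [lintegral_const_mul _ (by fun_prop), aux_tilt_lintegral 0 _ (by norm_num),
          ← ENNReal.ofReal_mul (Real.exp_pos _).le]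
        simp only [add_zero, Real.sqrt_one, div_one, one_mul, mul_one]
        rw [← Real.exp_add]
        congr 2; ring
      rw [lintegral_add_left (by fun_prop), aux b]
      have := aux (-b)
      simp only [neg_sq] at this
      rw [this])
  have hK : H (0, 0) = ENNReal.ofReal 2 := by
    simp only [H]
    rw [← ENNReal.ofReal_add (Real.exp_pos _).le (Real.exp_pos _).le]
    congr 1; norm_num
  rw [hK] at hch
  have hAm : ∀ t, Measurable (A t) := by
    intro t
    have : A t = fun ω => ∑ s ∈ Finset.range t, g (φ s ω) ^ 2 := funext (hA t)
    rw [this]; fun_prop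
  have hSm : ∀ t, Measurable (S t) := by
    intro t
    have : S t = fun ω => ∑ s ∈ Finset.range t, g (φ s ω) * ξ s ω := funext (hS t)
    rw [this]; fun_prop
  have := aux_markov (fun ω => H (A t ω, S t ω)) (hH.comp ((hAm t).prodMk (hSm t)))
    {ω | y * A t ω ^ 2 ≤ S t ω ^ 2} (Real.exp (y / 2)) 2 (Real.exp_pos _) (by
      filter_upwards [hA1] with ω h1 h2
      replace h2 : y * A t ω ^ 2 ≤ S t ω ^ 2 := h2
      have h3 : b * A t ω ≤ |S t ω| := by
        apply abs_le_of_sq_le_sq' _ (abs_nonneg _) |>.2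
        rw [sq_abs, mul_pow, hb2]; exact h2
      have h4 : y / 2 ≤ b * |S t ω| - b ^ 2 * A t ω / 2 := by
        have := mul_le_mul_of_nonneg_left h3 hb0
        rw [hb2]
        have h5 : b * (b * A t ω) = y * A t ω := by rw [← hb2]; ring
        nlinarith
      simp only [H]
      rcases abs_cases (S t ω) with ⟨h, _⟩ | ⟨h, _⟩
      · rw [h] at h4
        refine le_trans (ENNReal.ofReal_le_ofReal (Real.exp_le_exp.2 h4)) le_self_add
      · rw [h] at h4
        refine le_trans (ENNReal.ofReal_le_ofReal (Real.exp_le_exp.2 (h4.trans ?_))) le_add_self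
        linarith) hch
  refine this.trans (ENNReal.ofReal_le_ofReal (le_of_eq ?_))
  rw [div_eq_mul_inv, ← Real.exp_neg, neg_div]

lemma aux_bump
    (ξ : ℕ → Ω → ℝ) (φ : ℕ → Ω → F) (g : F → ℝ) (hg : Measurable g)
    (hξmeas : ∀ s, Measurable (ξ s)) (hφmeas : ∀ s, Measurable (φ s))
    (hgauss : ∀ s, Measure.map (ξ s) ℙ = gaussianReal 0 1)
    (hindep : ∀ s, Indep (MeasurableSpace.comap (ξ s) inferInstance)
      ((⨆ i ∈ Finset.range (s + 1), MeasurableSpace.comap (φ i) inferInstance) ⊔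
       (⨆ i ∈ Finset.range s, MeasurableSpace.comap (ξ i) inferInstance)) ℙ)
    (A S : ℕ → Ω → ℝ) (hA : ∀ t ω, A t ω = ∑ s ∈ Finset.range t, g (φ s ω) ^ 2)
    (hS : ∀ t ω, S t ω = ∑ s ∈ Finset.range t, g (φ s ω) * ξ s ω)
    (t : ℕ) (hA1 : ∀ᵐ ω ∂ℙ, 1 ≤ A t ω) (y x V κ : ℝ) (hy : 0 < y)
    (hAx : ∀ ω, A t ω ≤ x) (hx : 1 ≤ x) (hV : x < V) (hκ : 0 ≤ κ)
    (hVκ : y * (V - 1) + κ * (V - 1) ^ 2 ≤ y ^ 2) :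
    ℙ {ω | y * A t ω ^ 2 ≤ S t ω ^ 2} ≤ ENNReal.ofReal
      (1 - (1 / √V * (κ + y / V)) / (1 / √(V - x) * (κ + y / (V - x)))) := by
  set C := 1 / √(V - x) * (κ + y / (V - x)) with hC
  have hw : 0 < V - x := by linarith
  have hC0 : 0 < C := by
    have : 0 < √(V - x) := Real.sqrt_pos.2 hw
    positivity
  have hbC : ∀ B S : ℝ, V - x ≤ B → bumpP y κ B S ≤ C := by
    intro B S hB
    have hBp : 0 < B := by linarith
    have hsB : 0 < √B := Real.sqrt_pos.2 hBp
    have hsw : 0 < √(V - x) := Real.sqrt_pos.2 hw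
    unfold bumpP
    have e1 : Real.exp (-S ^ 2 / (2 * B)) ≤ 1 := by
      rw [Real.exp_le_one_iff, neg_div]
      have : 0 ≤ S ^ 2 / (2 * B) := by positivity
      linarith
    have e2 : κ + y / B - y * S ^ 2 / B ^ 2 ≤ κ + y / B := by
      have : 0 ≤ y * S ^ 2 / B ^ 2 := by positivity
      linarith
    have e3 : Real.exp (-S ^ 2 / (2 * B)) * (κ + y / B - y * S ^ 2 / B ^ 2) ≤ κ + y / B := by
      calc _ ≤ Real.exp (-S ^ 2 / (2 * B)) * (κ + y / B) :=
            mul_le_mul_of_nonneg_left e2 (Real.exp_pos _).le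
        _ ≤ 1 * (κ + y / B) := mul_le_mul_of_nonneg_right e1 (by positivity)
        _ = _ := one_mul _
    calc _ ≤ 1 / √B * (κ + y / B) := mul_le_mul_of_nonneg_left e3 (by positivity)
      _ ≤ C := by
        rw [hC]
        have : √(V - x) ≤ √B := Real.sqrt_le_sqrt hB
        gcongr
  let H : ℝ × ℝ → ENNReal := fun z => ENNReal.ofReal (C - bumpP y κ (V - z.1) z.2)
  have hH : Measurable H := by unfold H bumpP; fun_prop
  have hmono : ∀ s ≤ t, ∀ ω, A s ω ≤ A t ω := by
    intro s hs ω
    rw [hA, hA]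
    exact Finset.sum_le_sum_of_subset_of_nonneg (Finset.range_subset_range.2 hs)
      (fun _ _ _ => sq_nonneg _)
  have hch := aux_chain ξ φ hξmeas hφmeas hgauss hindep (fun t ω => (A t ω, S t ω))
    (fun z f x => (z.1 + g f ^ 2, z.2 + g f * x)) (by fun_prop) (0, 0)
    (by intro ω; simp [hA, hS])
    (by intro s ω; simp [hA, hS, Finset.sum_range_succ])
    H hH t (by
      intro s hs ω
      have h1 : A s ω + g (φ s ω) ^ 2 ≤ x := by
        have h2 : A (s + 1) ω = A s ω + g (φ s ω) ^ 2 := by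
          simp [hA, Finset.sum_range_succ]
        rw [← h2]
        exact (hmono _ hs ω).trans (hAx ω)
      simp only [H]
      generalize A s ω = A0 at *
      generalize S s ω = S0
      generalize g (φ s ω) = f at *
      have hB : 0 < (V - A0) - f ^ 2 := by linarith
      have e : V - (A0 + f ^ 2) = (V - A0) - f ^ 2 := by ring
      rw [e]
      have hi := aux_bump_integrable y κ ((V - A0) - f ^ 2) S0 f hB
      have hi2 : Integrable (fun x => C - bumpP y κ ((V - A0) - f ^ 2) (S0 + f * x))
        (gaussianReal 0 1) := (integrable_const C).sub hi
      rw [← ofReal_integral_eq_lintegral_ofReal hi2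
        (ae_of_all _ fun x => sub_nonneg.2 (hbC _ _ (by linarith)))]
      rw [integral_sub (integrable_const C) hi, aux_bump_step _ _ _ _ _ hB]
      simp)
  have hAm : ∀ t, Measurable (A t) := by
    intro t
    have : A t = fun ω => ∑ s ∈ Finset.range t, g (φ s ω) ^ 2 := funext (hA t)
    rw [this]; fun_prop
  have hSm : ∀ t, Measurable (S t) := by
    intro t
    have : S t = fun ω => ∑ s ∈ Finset.range t, g (φ s ω) * ξ s ω := funext (hS t)
    rw [this]; fun_prop
  have := aux_markov (fun ω => H (A t ω, S t ω)) (hH.comp ((hAm t).prodMk (hSm t)))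
    {ω | y * A t ω ^ 2 ≤ S t ω ^ 2} C (C - bumpP y κ (V - 0) 0) hC0 (by
      filter_upwards [hA1] with ω h1 h2
      replace h2 : y * A t ω ^ 2 ≤ S t ω ^ 2 := h2
      simp only [H]
      apply ENNReal.ofReal_le_ofReal
      have hx' := hAx ω
      generalize A t ω = A0 at *
      generalize S t ω = S0 at *
      set B := V - A0 with hBdef
      have hB : 0 < B := by linarith
      have hB1 : B ≤ V - 1 := by linarith
      suffices hneg : bumpP y κ B S0 ≤ 0 by linarith
      unfold bumpP
      have hsB : 0 < √B := Real.sqrt_pos.2 hB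
      refine mul_nonpos_of_nonneg_of_nonpos (by positivity)
        (mul_nonpos_of_nonneg_of_nonpos (Real.exp_pos _).le ?_)
      have e : κ + y / B - y * S0 ^ 2 / B ^ 2 = (κ * B ^ 2 + y * B - y * S0 ^ 2) / B ^ 2 := by
        field_simp
      rw [e]
      refine div_nonpos_of_nonpos_of_nonneg ?_ (by positivity)
      have k1 : κ * B ^ 2 ≤ κ * (V - 1) ^ 2 := by gcongr
      have k2 : y * B ≤ y * (V - 1) := by gcongr
      have k3 : y ≤ S0 ^ 2 := by
        have : y * 1 ≤ y * A0 ^ 2 := by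
          gcongr; nlinarith
        linarith
      nlinarith) hch
  refine this.trans (ENNReal.ofReal_le_ofReal (le_of_eq ?_))
  rw [sub_div, div_self hC0.ne']
  congr 2
  unfold bumpP
  simp
end onedim

lemma aux_poly_cert (u τ : ℝ) (hu : 0 ≤ u) (hu1 : u ≤ 1) (hτ : 0 ≤ τ) (hτ1 : τ ≤ 1) (m r Y W : ℝ)
    (hm : m = 3 / 10 * u) (hr : r = (2773 / 1000 - 8 * m) * τ) (hY : Y = 16 * m + 4 * r)
    (hW : W = Y * (1 - m) - 10 * m) :
    0 ≤ 1 / 2 * W ^ 2 * (1 + Y) * (8 + r)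
      - r * (5 + Y) * (W + 1 / 4 * (5 + Y) * (1 - m)) * (Y * (1 - m) - 2 * m) := by
  have h1 : 0 ≤ 1 - u := by linarith
  have h2 : 0 ≤ 1 - τ := by linarith
  have e : 1 / 2 * W ^ 2 * (1 + Y) * (8 + r)
      - r * (5 + Y) * (W + 1 / 4 * (5 + Y) * (1 - m)) * (Y * (1 - m) - 2 * m) =
      (324 / 25) * τ ^ 0 * (1 - τ) ^ 4 * u ^ 2 * (1 - u) ^ 3 +
      (10044 / 125) * τ ^ 0 * (1 - τ) ^ 4 * u ^ 3 * (1 - u) ^ 2 +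
      (19116 / 625) * τ ^ 0 * (1 - τ) ^ 4 * u ^ 4 * (1 - u) ^ 1 +
      (9396 / 3125) * τ ^ 0 * (1 - τ) ^ 4 * u ^ 5 * (1 - u) ^ 0 +
      (1738671 / 20000) * τ ^ 1 * (1 - τ) ^ 3 * u ^ 1 * (1 - u) ^ 5 +
      (190541973 / 200000) * τ ^ 1 * (1 - τ) ^ 3 * u ^ 2 * (1 - u) ^ 4 +
      (413144787 / 250000) * τ ^ 1 * (1 - τ) ^ 3 * u ^ 3 * (1 - u) ^ 3 +
      (479393277 / 500000) * τ ^ 1 * (1 - τ) ^ 3 * u ^ 4 * (1 - u) ^ 2 +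
      (2043993999 / 12500000) * τ ^ 1 * (1 - τ) ^ 3 * u ^ 5 * (1 - u) ^ 1 +
      (236292573 / 25000000) * τ ^ 1 * (1 - τ) ^ 3 * u ^ 6 * (1 - u) ^ 0 +
      (299891631 / 1000000) * τ ^ 2 * (1 - τ) ^ 2 * u ^ 0 * (1 - u) ^ 6 +
      (19677820833 / 5000000) * τ ^ 2 * (1 - τ) ^ 2 * u ^ 1 * (1 - u) ^ 5 +
      (919433536263 / 100000000) * τ ^ 2 * (1 - τ) ^ 2 * u ^ 2 * (1 - u) ^ 4 +
      (1071183324729 / 125000000) * τ ^ 2 * (1 - τ) ^ 2 * u ^ 3 * (1 - u) ^ 3 +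
      (4214760326883 / 1250000000) * τ ^ 2 * (1 - τ) ^ 2 * u ^ 4 * (1 - u) ^ 2 +
      (67410959337 / 156250000) * τ ^ 2 * (1 - τ) ^ 2 * u ^ 5 * (1 - u) ^ 1 +
      (41694842631 / 2500000000) * τ ^ 2 * (1 - τ) ^ 2 * u ^ 6 * (1 - u) ^ 0 +
      (28674253641 / 7812500) * τ ^ 3 * (1 - τ) ^ 1 * u ^ 0 * (1 - u) ^ 6 +
      (15987362300007 / 1250000000) * τ ^ 3 * (1 - τ) ^ 1 * u ^ 1 * (1 - u) ^ 5 +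
      (230237195676321 / 12500000000) * τ ^ 3 * (1 - τ) ^ 1 * u ^ 2 * (1 - u) ^ 4 +
      (204527273799399 / 15625000000) * τ ^ 3 * (1 - τ) ^ 1 * u ^ 3 * (1 - u) ^ 3 +
      (135314361044529 / 31250000000) * τ ^ 3 * (1 - τ) ^ 1 * u ^ 4 * (1 - u) ^ 2 +
      (15708994338999 / 31250000000) * τ ^ 3 * (1 - τ) ^ 1 * u ^ 5 * (1 - u) ^ 1 +
      (1045701277281 / 62500000000) * τ ^ 3 * (1 - τ) ^ 1 * u ^ 6 * (1 - u) ^ 0 +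
      (33264233464977 / 62500000000) * τ ^ 4 * (1 - τ) ^ 0 * u ^ 0 * (1 - u) ^ 6 +
      (1075227355773129 / 312500000000) * τ ^ 4 * (1 - τ) ^ 0 * u ^ 1 * (1 - u) ^ 5 +
      (39547906173039693 / 6250000000000) * τ ^ 4 * (1 - τ) ^ 0 * u ^ 2 * (1 - u) ^ 4 +
      (7612957291560243 / 1562500000000) * τ ^ 4 * (1 - τ) ^ 0 * u ^ 3 * (1 - u) ^ 3 +
      (5048481514982529 / 3125000000000) * τ ^ 4 * (1 - τ) ^ 0 * u ^ 4 * (1 - u) ^ 2 +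
      (145582421379909 / 781250000000) * τ ^ 4 * (1 - τ) ^ 0 * u ^ 5 * (1 - u) ^ 1 +
      (37768703240373 / 6250000000000) * τ ^ 4 * (1 - τ) ^ 0 * u ^ 6 * (1 - u) ^ 0 := by
    subst hW hY hr hm
    ring
  rw [e]
  positivity

lemma aux_log_ge (m : ℝ) (h0 : 0 ≤ m) (h1 : m < 1) : 2 * m ≤ Real.log ((1 + m) / (1 - m)) := by
  have h := Real.hasSum_log_sub_log_of_abs_lt_one (x := m) (by rw [abs_of_nonneg h0]; exact h1)
  rw [Real.log_div (by linarith) (by linarith)]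
  have := le_hasSum h 0 (fun j _ => by positivity)
  simpa using this

lemma aux_exp_ge (z : ℝ) (hz : 0 ≤ z) : (2 - z) / (2 + z) ≤ Real.exp (-z) := by
  by_cases h2 : 2 ≤ z
  · refine le_trans (div_nonpos_of_nonpos_of_nonneg (by linarith) (by linarith)) (Real.exp_pos _).le
  have h := aux_log_ge (z / 2) (by linarith) (by linarith)
  have e : (1 + z / 2) / (1 - z / 2) = (2 + z) / (2 - z) := by
    have : 2 - z ≠ 0 := by linarith
    have : 1 - z / 2 ≠ 0 := by linarith
    field_simp
  rw [e, show 2 * (z / 2) = z by ring] at h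
  have hp : 0 < (2 + z) / (2 - z) := div_pos (by linarith) (by linarith)
  rw [Real.le_log_iff_exp_le hp] at h
  rw [Real.exp_neg, ← inv_div]
  exact inv_anti₀ (Real.exp_pos _) h

lemma aux_setup (x y : ℝ) (hx1 : 1 ≤ x) (h1 : 2 * Real.log x < y)
    (h2 : y ≤ 4 * Real.log 2 - 2 * Real.log x) :
    ∃ m r : ℝ, 0 ≤ m ∧ m < 1 ∧ (x - 1) * (1 - m) = 2 * m ∧ y = 4 * m + r ∧ 0 < r ∧
      r ≤ 2773 / 1000 - 8 * m ∧ Real.exp (- (r / 4)) ≤ √x * Real.exp (-y / 4) := by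
  have hx0 : 0 < x + 1 := by linarith
  set m := (x - 1) / (x + 1) with hm
  have hm0 : 0 ≤ m := div_nonneg (by linarith) hx0.le
  have hm1 : m < 1 := by rw [hm, div_lt_one hx0]; linarith
  have hmx : (1 + m) / (1 - m) = x := by
    have : 1 - m ≠ 0 := by linarith
    rw [div_eq_iff this, hm]; field_simp; ring
  have hlog := aux_log_ge m hm0 hm1
  rw [hmx] at hlog
  have hl2 := Real.log_two_lt_d9
  refine ⟨m, y - 4 * m, hm0, hm1, ?_, by ring, by linarith, by norm_num at *; linarith, ?_⟩
  · rw [hm]; field_simp; ring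
  · have : √x = Real.exp (Real.log x / 2) := by
      rw [Real.exp_half, Real.exp_log (by linarith)]
    rw [this, ← Real.exp_add, Real.exp_le_exp]
    linarith

lemma aux_ratio (y κ V w : ℝ) (hV : 0 < V) (hw : 0 < w) (hy : 0 < y) (hκ : 0 ≤ κ) :
    (1 / √V * (κ + y / V)) / (1 / √w * (κ + y / w)) =
      √(w / V) * ((w * (κ * V + y)) / (V * (κ * w + y))) := by
  have h1 : 0 < √V := Real.sqrt_pos.2 hV
  have h2 : 0 < √w := Real.sqrt_pos.2 hw
  rw [Real.sqrt_div hw.le]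
  have : 0 < κ * w + y := by positivity
  have h3 : κ + y / w = (κ * w + y) / w := by field_simp
  rw [h3]
  field_simp

lemma aux_numI (x y : ℝ) (hx1 : 1 ≤ x) (hx2 : x ≤ 13 / 7) (h1 : 2 * Real.log x < y)
    (h2 : y ≤ 4 * Real.log 2 - 2 * Real.log x) :
    x < 1 + 4 / 5 * y ∧
    1 - (1 / √(1 + 4 / 5 * y) * (5 / 16 + y / (1 + 4 / 5 * y))) /
      (1 / √(1 + 4 / 5 * y - x) * (5 / 16 + y / (1 + 4 / 5 * y - x))) ≤ √x * Real.exp (-y / 4) := by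
  obtain ⟨m, r, hm0, hm1, hxm, hyr, hr0, hr1, hexp⟩ := aux_setup x y hx1 h1 h2
  have hm3 : m ≤ 3 / 10 := by nlinarith
  have hn : 0 < 1 - m := by linarith
  set w := 1 + 4 / 5 * y - x with hwdef
  set V := 1 + 4 / 5 * y with hVdef
  have hWw : (16 * m + 4 * r) * (1 - m) - 10 * m = 5 * (1 - m) * w := by
    rw [hwdef, hVdef, hyr]; linear_combination 5 * hxm
  have hwp : 0 < w := by
    have : 0 < (1 - m) * w := by
      have : 0 < (16 * m + 4 * r) * (1 - m) - 10 * m := by nlinarith [mul_pos hr0 hn]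
      nlinarith
    exact (pos_iff_pos_of_mul_pos this).1 hn
  refine ⟨by linarith, ?_⟩
  have hy : 0 < y := by linarith
  have hVp : 0 < V := by positivity
  rw [aux_ratio y (5/16) V w hVp hwp hy (by norm_num)]
  have hR : 0 < w / V := by positivity
  have hsq : (w / V) / (w / V + 1 / 4) ≤ √(w / V) := by
    rw [div_le_iff₀ (by positivity)]
    have h3 := Real.sq_sqrt hR.le
    have h4 : 0 < √(w / V) := Real.sqrt_pos.2 hR
    nlinarith [mul_nonneg h4.le (sq_nonneg (√(w / V) - 1 / 2))]
  have hR0 : 0 < 2773 / 1000 - 8 * m := by linarith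
  have hcert := aux_poly_cert (m / (3 / 10)) (r / (2773 / 1000 - 8 * m)) (by positivity)
    (by rw [div_le_one (by norm_num)]; exact hm3) (by positivity) (by rw [div_le_one hR0]; exact hr1)
    m r (4 * y) (5 * (1 - m) * w) (by ring) (by rw [mul_comm, div_mul_cancel₀ _ hR0.ne']) (by rw [hyr]; ring)
    (by rw [← hWw, hyr]; ring)
  have hex := aux_exp_ge (r / 4) (by positivity)
  have hpos : 0 < 5 / 16 * w + y := by positivity
  have hmain : 2 * r / (8 + r) ≤
      (w / V) / (w / V + 1 / 4) * ((w * (5 / 16 * V + y)) / (V * (5 / 16 * w + y))) := by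
    have e : (w / V) / (w / V + 1 / 4) * ((w * (5 / 16 * V + y)) / (V * (5 / 16 * w + y))) =
      (4 * w ^ 2 * (5 / 16 * V + y)) / ((4 * w + V) * V * (5 / 16 * w + y)) := by
      field_simp
    rw [e, div_le_div_iff₀ (by positivity) (by positivity)]
    have hxx : x = 1 + 4 / 5 * y - w := by rw [hwdef]; ring
    have e2 : 4 * y * (1 - m) - 2 * m = (1 - m) * (16 / 5 * (5 / 16 * w + y)) := by
      rw [← hxm, hxx]; ring
    have e3 : 5 + 4 * y = 5 * V := by rw [hVdef]; ring
    have e4 : 1 + 4 * y = 16 / 5 * (5 / 16 * V + y) := by rw [hVdef]; ring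
    rw [e2, e3, e4] at hcert
    have e5 : 1 / 2 * (5 * (1 - m) * w) ^ 2 * (16 / 5 * (5 / 16 * V + y)) * (8 + r) -
      r * (5 * V) * (5 * (1 - m) * w + 1 / 4 * (5 * V) * (1 - m)) *
        ((1 - m) * (16 / 5 * (5 / 16 * w + y))) = (1 - m) ^ 2 * 10 *
        (4 * w ^ 2 * (5 / 16 * V + y) * (8 + r) - 2 * r * ((4 * w + V) * V * (5 / 16 * w + y))) := by
      ring
    rw [e5] at hcert
    have := nonneg_of_mul_nonneg_right hcert (by positivity)
    linarith
  have hfin : 2 * r / (8 + r) ≤ √(w / V) * ((w * (5 / 16 * V + y)) / (V * (5 / 16 * w + y))) :=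
    hmain.trans (mul_le_mul_of_nonneg_right hsq (by positivity))
  have e6 : (2 - r / 4) / (2 + r / 4) = 1 - 2 * r / (8 + r) := by
    field_simp; ring
  rw [e6] at hex
  linarith

lemma aux_numII (x y : ℝ) (hx1 : 13 / 7 ≤ x) (hx2 : x ≤ 2) (h1 : 2 * Real.log x < y)
    (h2 : y ≤ 4 * Real.log 2 - 2 * Real.log x) :
    x < 1 + y ∧
    1 - (1 / √(1 + y) * (0 + y / (1 + y))) /
      (1 / √(1 + y - x) * (0 + y / (1 + y - x))) ≤ √x * Real.exp (-y / 4) := by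
  obtain ⟨m, r, hm0, hm1, hxm, hyr, hr0, hr1, hexp⟩ := aux_setup x y (by linarith) h1 h2
  have hm3 : 3 / 10 ≤ m := by nlinarith
  have hm4 : m ≤ 1 / 3 := by nlinarith
  have hxm2 : x ≤ 1 + 3 * m := by nlinarith
  have hn : 0 < 1 - m := by linarith
  set w := 1 + y - x with hwdef
  have hw1 : 1369 / 10000 * (1 + y) ≤ w := by
    rw [hwdef, hyr]
    nlinarith
  have hy : 0 < y := by linarith
  have hwp : 0 < w := lt_of_lt_of_le (by positivity) hw1
  refine ⟨by linarith, ?_⟩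
  rw [aux_ratio y 0 (1 + y) w (by linarith) hwp hy le_rfl]
  have hs : 37 / 100 ≤ √(w / (1 + y)) := by
    apply Real.le_sqrt_of_sq_le
    rw [le_div_iff₀ (by positivity)]
    norm_num; linarith
  have e : w * (0 * (1 + y) + y) / ((1 + y) * (0 * w + y)) = w / (1 + y) := by
    field_simp; ring
  rw [e]
  have h5 : r / 4 ≤ 37 / 100 * (w / (1 + y)) := by
    rw [← mul_div_assoc, le_div_iff₀ (by positivity), hwdef, hyr]
    nlinarith
  have h6 : 37 / 100 * (w / (1 + y)) ≤ √(w / (1 + y)) * (w / (1 + y)) :=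
    mul_le_mul_of_nonneg_right hs (by positivity)
  have h7 := Real.add_one_le_exp (-(r / 4))
  linarith

section onedim2
variable {Ω : Type*} [MeasureSpace Ω] [IsProbabilityMeasure (ℙ : Measure Ω)]
    {F : Type*} [MeasurableSpace F]

lemma aux_onedim
    (ξ : ℕ → Ω → ℝ) (φ : ℕ → Ω → F) (g : F → ℝ) (hg : Measurable g)
    (hξmeas : ∀ s, Measurable (ξ s)) (hφmeas : ∀ s, Measurable (φ s))
    (hgauss : ∀ s, Measure.map (ξ s) ℙ = gaussianReal 0 1)
    (hindep : ∀ s, Indep (MeasurableSpace.comap (ξ s) inferInstance)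
      ((⨆ i ∈ Finset.range (s + 1), MeasurableSpace.comap (φ i) inferInstance) ⊔
       (⨆ i ∈ Finset.range s, MeasurableSpace.comap (ξ i) inferInstance)) ℙ)
    (A S : ℕ → Ω → ℝ) (hA : ∀ t ω, A t ω = ∑ s ∈ Finset.range t, g (φ s ω) ^ 2)
    (hS : ∀ t ω, S t ω = ∑ s ∈ Finset.range t, g (φ s ω) * ξ s ω)
    (t : ℕ) (hA1 : ∀ᵐ ω ∂ℙ, 1 ≤ A t ω) (y x : ℝ) (hy : 0 < y)
    (hAx : ∀ ω, A t ω ≤ x) :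
    ℙ {ω | y * A t ω ^ 2 ≤ S t ω ^ 2} ≤ ENNReal.ofReal (√x * Real.exp (-y / 4)) := by
  have hx : 1 ≤ x := by
    obtain ⟨ω, hω⟩ := hA1.exists
    exact hω.trans (hAx ω)
  have hsx : √x = Real.exp (Real.log x / 2) := by
    rw [Real.exp_half, Real.exp_log (by linarith)]
  by_cases h1 : y ≤ 2 * Real.log x
  · refine prob_le_one.trans ?_
    rw [← ENNReal.ofReal_one]
    apply ENNReal.ofReal_le_ofReal
    rw [hsx, ← Real.exp_add, Real.one_le_exp_iff]
    linarith
  push Not at h1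
  by_cases h2 : 4 * Real.log 2 - 2 * Real.log x ≤ y
  · refine (aux_cosh ξ φ g hg hξmeas hφmeas hgauss hindep A S hA hS t hA1 y hy.le).trans ?_
    apply ENNReal.ofReal_le_ofReal
    have : (2 : ℝ) = Real.exp (Real.log 2) := by rw [Real.exp_log (by norm_num)]
    rw [hsx, this, ← Real.exp_add, ← Real.exp_add, Real.exp_le_exp, ← this]
    linarith
  push Not at h2
  by_cases h3 : x ≤ 13 / 7
  · obtain ⟨k1, k2⟩ := aux_numI x y hx h3 h1 h2.le
    refine (aux_bump ξ φ g hg hξmeas hφmeas hgauss hindep A S hA hS t hA1 y x (1 + 4 / 5 * y) (5 / 16)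
      hy hAx hx k1 (by norm_num) (by nlinarith)).trans (ENNReal.ofReal_le_ofReal k2)
  · push Not at h3
    have hx2 : x ≤ 2 := by
      have : Real.log x ≤ Real.log 2 := by linarith
      exact (Real.log_le_log_iff (by linarith) (by norm_num)).1 this
    obtain ⟨k1, k2⟩ := aux_numII x y h3.le hx2 h1 h2.le
    refine (aux_bump ξ φ g hg hξmeas hφmeas hgauss hindep A S hA hS t hA1 y x (1 + y) 0
      hy hAx hx k1 le_rfl (by nlinarith)).trans (ENNReal.ofReal_le_ofReal k2)
end onedim2

lemma aux_op_smul {d : ℕ} (k : ℝ) (v : Fin d → ℝ) : MulOpposite.op k • v = k • v := by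
  ext i; simp [mul_comm]

lemma aux_dot_symm {d : ℕ} (N : Matrix (Fin d) (Fin d) ℝ) (hN : Nᵀ = N) (v w : Fin d → ℝ) :
    v ⬝ᵥ N *ᵥ w = w ⬝ᵥ N *ᵥ v := by
  rw [dotProduct_mulVec, ← mulVec_transpose, hN, dotProduct_comm]

lemma aux_psd_vv {d : ℕ} (f : Fin d → ℝ) : (vecMulVec f f).PosSemidef := by
  have := posSemidef_vecMulVec_self_star f
  simpa using this

lemma aux_det_rank1 {d : ℕ} (M : Matrix (Fin d) (Fin d) ℝ) (hM : M.PosDef) (f : Fin d → ℝ) :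
    (M + vecMulVec f f).det = M.det * (1 + f ⬝ᵥ M⁻¹ *ᵥ f) := by
  have hu : IsUnit M.det := hM.det_pos.ne'.isUnit
  rw [vecMulVec_eq Unit, det_add_replicateCol_mul_replicateRow hu]
  congr 1
  rw [det_unique]
  simp [Matrix.mul_apply, dotProduct, mulVec, Finset.mul_sum, Finset.sum_mul]
  rw [Finset.sum_comm]
  simp [mul_assoc]

lemma aux_inv_rank1 {d : ℕ} (M : Matrix (Fin d) (Fin d) ℝ) (hM : M.PosDef) (f : Fin d → ℝ) :
    (M + vecMulVec f f)⁻¹ = M⁻¹ - (1 / (1 + f ⬝ᵥ M⁻¹ *ᵥ f)) •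
      vecMulVec (M⁻¹ *ᵥ f) (M⁻¹ *ᵥ f) := by
  have hu : IsUnit M.det := hM.det_pos.ne'.isUnit
  have hNt : (M⁻¹)ᵀ = M⁻¹ := by
    have := hM.inv.1
    simpa [Matrix.IsHermitian] using this
  have hnn : 0 ≤ f ⬝ᵥ M⁻¹ *ᵥ f := by
    simpa using hM.inv.posSemidef.dotProduct_mulVec_nonneg f
  apply inv_eq_right_inv
  have e1 : vecMulVec f f * M⁻¹ = vecMulVec f (M⁻¹ *ᵥ f) := by
    rw [vecMulVec_mul, ← mulVec_transpose, hNt]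
  have e2 : M * vecMulVec (M⁻¹ *ᵥ f) (M⁻¹ *ᵥ f) = vecMulVec f (M⁻¹ *ᵥ f) := by
    rw [mul_vecMulVec, mulVec_mulVec, mul_nonsing_inv _ hu, one_mulVec]
  have e3 : vecMulVec f f * vecMulVec (M⁻¹ *ᵥ f) (M⁻¹ *ᵥ f) =
      (f ⬝ᵥ M⁻¹ *ᵥ f) • vecMulVec f (M⁻¹ *ᵥ f) := by
    ext i j
    simp [vecMulVec_apply, Matrix.mul_apply, dotProduct, Finset.sum_mul]
    refine Finset.sum_congr rfl fun k _ => ?_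
    ring
  rw [mul_sub, add_mul, mul_nonsing_inv _ hu, e1, mul_smul_comm, add_mul, e2, e3]
  ext i j
  simp only [Matrix.sub_apply, Matrix.add_apply, Matrix.smul_apply, smul_eq_mul]
  field_simp
  ring

lemma aux_quad_rank1 {d : ℕ} (M : Matrix (Fin d) (Fin d) ℝ) (hM : M.PosDef) (f S : Fin d → ℝ)
    (x : ℝ) :
    (S + x • f) ⬝ᵥ (M + vecMulVec f f)⁻¹ *ᵥ (S + x • f) = S ⬝ᵥ M⁻¹ *ᵥ S +
      (1 / (1 + f ⬝ᵥ M⁻¹ *ᵥ f)) * (2 * x * (S ⬝ᵥ M⁻¹ *ᵥ f) + x ^ 2 * (f ⬝ᵥ M⁻¹ *ᵥ f)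
        - (S ⬝ᵥ M⁻¹ *ᵥ f) ^ 2) := by
  have hNt : (M⁻¹)ᵀ = M⁻¹ := by
    have := hM.inv.1
    simpa [Matrix.IsHermitian] using this
  have hnn : 0 ≤ f ⬝ᵥ M⁻¹ *ᵥ f := by
    simpa using hM.inv.posSemidef.dotProduct_mulVec_nonneg f
  have e1 : f ⬝ᵥ M⁻¹ *ᵥ S = S ⬝ᵥ M⁻¹ *ᵥ f := aux_dot_symm _ hNt _ _
  rw [aux_inv_rank1 M hM f]
  simp only [sub_mulVec, smul_mulVec, vecMulVec_mulVec, aux_op_smul, mulVec_add, mulVec_smul,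
    dotProduct_add, add_dotProduct, dotProduct_sub, dotProduct_smul, smul_dotProduct, smul_eq_mul,
    e1]
  rw [dotProduct_comm (M⁻¹ *ᵥ f) S, dotProduct_comm (M⁻¹ *ᵥ f) f]
  field_simp
  ring

/-- The mixture functional. -/
def auxH {d : ℕ} (M : Matrix (Fin d) (Fin d) ℝ) (S : Fin d → ℝ) : ENNReal :=
  ENNReal.ofReal (1 / √M.det * Real.exp (1 / 2 * (S ⬝ᵥ M⁻¹ *ᵥ S)))

lemma aux_onestep {d : ℕ} (M : Matrix (Fin d) (Fin d) ℝ) (hM : M.PosDef) (f S : Fin d → ℝ) :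
    ∫⁻ x, auxH (M + vecMulVec f f) (S + x • f) ∂(gaussianReal 0 1) = auxH M S := by
  have hnn : 0 ≤ f ⬝ᵥ M⁻¹ *ᵥ f := by
    simpa using hM.inv.posSemidef.dotProduct_mulVec_nonneg f
  have hD := hM.det_pos
  unfold auxH
  simp only [aux_quad_rank1 M hM f S, aux_det_rank1 M hM f]
  set u := f ⬝ᵥ M⁻¹ *ᵥ f with hu
  set b := S ⬝ᵥ M⁻¹ *ᵥ f
  set q := S ⬝ᵥ M⁻¹ *ᵥ S
  set D := M.det
  have h1 : 0 < 1 + u := by linarith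
  have hal : (1 : ℝ) + (-u / (1 + u)) = 1 / (1 + u) := by field_simp; ring
  have key := aux_tilt_lintegral (-u / (1 + u)) (b / (1 + u)) (by rw [hal]; positivity)
  have e : ∀ x : ℝ, ENNReal.ofReal (1 / √(D * (1 + u)) *
      Real.exp (1 / 2 * (q + 1 / (1 + u) * (2 * x * b + x ^ 2 * u - b ^ 2)))) =
      ENNReal.ofReal (1 / √(D * (1 + u)) * Real.exp (1 / 2 * q - b ^ 2 / (2 * (1 + u)))) *
      ENNReal.ofReal (Real.exp (-((-u / (1 + u)) * x ^ 2) / 2 + (b / (1 + u)) * x)) := by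
    intro x
    rw [← ENNReal.ofReal_mul (by positivity), mul_assoc (1 / √(D * (1 + u))), ← Real.exp_add]
    congr 3
    field_simp
    ring
  simp only [e]
  rw [lintegral_const_mul _ (by fun_prop), key, hal, ← ENNReal.ofReal_mul (by positivity)]
  congr 1
  rw [Real.sqrt_mul hD.le, Real.sqrt_div zero_le_one, Real.sqrt_one]
  have hs : √(1 + u) ≠ 0 := (Real.sqrt_pos.mpr h1).ne'
  have hs2 : √D ≠ 0 := (Real.sqrt_pos.mpr hD).ne'
  have : Real.exp (1 / 2 * q - b ^ 2 / (2 * (1 + u))) *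
      Real.exp ((b / (1 + u)) ^ 2 / (2 * (1 / (1 + u)))) = Real.exp (1 / 2 * q) := by
    rw [← Real.exp_add]
    congr 1
    field_simp
    ring
  rw [← this]
  field_simp

lemma aux_H_meas {d : ℕ} : Measurable (fun p : (Fin d → Fin d → ℝ) × (Fin d → ℝ) =>
    auxH (Matrix.of p.1) p.2) := by
  unfold auxH
  have hof : Continuous (fun p : (Fin d → Fin d → ℝ) × (Fin d → ℝ) =>
    (Matrix.of p.1 : Matrix (Fin d) (Fin d) ℝ)) := continuous_fst
  have h1 : Continuous (fun p : (Fin d → Fin d → ℝ) × (Fin d → ℝ) => (Matrix.of p.1).det) :=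
    hof.matrix_det
  have h2 : Continuous (fun p : (Fin d → Fin d → ℝ) × (Fin d → ℝ) =>
      p.2 ⬝ᵥ (Matrix.of p.1).adjugate *ᵥ p.2) :=
    continuous_snd.dotProduct (hof.matrix_adjugate.matrix_mulVec continuous_snd)
  have h3 : ∀ p : (Fin d → Fin d → ℝ) × (Fin d → ℝ), p.2 ⬝ᵥ (Matrix.of p.1)⁻¹ *ᵥ p.2 =
      (Matrix.of p.1).det⁻¹ * (p.2 ⬝ᵥ (Matrix.of p.1).adjugate *ᵥ p.2) := by
    intro p
    rw [Matrix.inv_def, smul_mulVec, dotProduct_smul, Ring.inverse_eq_inv, smul_eq_mul]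
  simp only [h3]
  have m1 := h1.measurable
  have m2 := h2.measurable
  fun_prop

lemma aux_lam {d : ℕ} (A : Matrix (Fin d) (Fin d) ℝ) (hA : A.PosSemidef) (m : ℝ)
    (hm : m ≤ lambdaMin A) (v : Fin d → ℝ) : m * ∑ i, v i ^ 2 ≤ v ⬝ᵥ A *ᵥ v := by
  have hnn : ∀ w : Fin d → ℝ, 0 ≤ w ⬝ᵥ A *ᵥ w := fun w => by
    simpa using hA.dotProduct_mulVec_nonneg w
  set s := ∑ i, v i ^ 2 with hs
  have hs0 : 0 ≤ s := Finset.sum_nonneg fun i _ => sq_nonneg _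
  rcases hs0.eq_or_lt with h | h
  · rw [← h]; simpa using hnn v
  have hsq : 0 < √s := Real.sqrt_pos.mpr h
  have hss : √s ^ 2 = s := Real.sq_sqrt hs0
  have hw : ∑ i, (((√s)⁻¹ • v) i) ^ 2 = 1 := by
    simp only [Pi.smul_apply, smul_eq_mul, mul_pow]
    rw [← Finset.mul_sum, ← hs, inv_pow, hss, inv_mul_cancel₀ h.ne']
  have hb : BddBelow (Set.range fun v : {v : Fin d → ℝ // ∑ i, v i ^ 2 = 1} =>
      v.1 ⬝ᵥ A.mulVec v.1) := ⟨0, by rintro _ ⟨w, rfl⟩; exact hnn _⟩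
  have h1 := hm.trans (ciInf_le hb ⟨(√s)⁻¹ • v, hw⟩)
  simp only [mulVec_smul, dotProduct_smul, smul_dotProduct, smul_eq_mul] at h1
  have e : (√s)⁻¹ * ((√s)⁻¹ * (v ⬝ᵥ A *ᵥ v)) = (v ⬝ᵥ A *ᵥ v) / s := by
    rw [← mul_assoc, ← mul_inv, ← sq, hss]; field_simp
  rw [e, le_div_iff₀ h] at h1
  exact h1

lemma aux_psd_sum {d : ℕ} (f : ℕ → Fin d → ℝ) (t : ℕ) :
    (∑ s ∈ Finset.range t, vecMulVec (f s) (f s)).PosSemidef :=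
  posSemidef_sum _ fun s _ => aux_psd_vv (f s)

lemma aux_posdef {d : ℕ} (A : Matrix (Fin d) (Fin d) ℝ) (hA : A.PosSemidef) (m : ℝ) (hm0 : 0 < m)
    (hm : ∀ v : Fin d → ℝ, m * ∑ i, v i ^ 2 ≤ v ⬝ᵥ A *ᵥ v) : A.PosDef := by
  refine PosDef.of_dotProduct_mulVec_pos hA.1 fun v hv => ?_
  have h1 : 0 < ∑ i, v i ^ 2 := by
    obtain ⟨i, hi⟩ := Function.ne_iff.mp hv
    refine Finset.sum_pos' (fun i _ => sq_nonneg _) ⟨i, Finset.mem_univ _, ?_⟩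
    have : v i ≠ 0 := hi
    positivity
  have := hm v
  simp only [star_trivial]
  have := mul_pos hm0 h1
  linarith

lemma aux_err {d : ℕ} (θ : Fin d → ℝ) (f : ℕ → Fin d → ℝ) (x r : ℕ → ℝ) (t : ℕ)
    (hr : ∀ s, r s = θ ⬝ᵥ f s + x s)
    (A : Matrix (Fin d) (Fin d) ℝ) (hA : A = ∑ s ∈ Finset.range t, vecMulVec (f s) (f s))
    (hP : A.PosDef) :
    A *ᵥ (A⁻¹ *ᵥ (∑ s ∈ Finset.range t, r s • f s) - θ) = ∑ s ∈ Finset.range t, x s • f s := by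
  have hu : IsUnit A.det := hP.det_pos.ne'.isUnit
  have e : A *ᵥ θ = ∑ s ∈ Finset.range t, (θ ⬝ᵥ f s) • f s := by
    rw [hA, sum_mulVec]
    refine Finset.sum_congr rfl fun s _ => ?_
    rw [vecMulVec_mulVec, aux_op_smul, dotProduct_comm]
  rw [mulVec_sub, mulVec_mulVec, mul_nonsing_inv _ hu, one_mulVec, e, ← Finset.sum_sub_distrib]
  refine Finset.sum_congr rfl fun s _ => ?_
  rw [hr, ← sub_smul]
  congr 1
  ring

lemma aux_quad_lower {d : ℕ} (M : Matrix (Fin d) (Fin d) ℝ) (hM : M.PosDef) (S z : Fin d → ℝ) :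
    2 * (S ⬝ᵥ z) - z ⬝ᵥ M *ᵥ z ≤ S ⬝ᵥ M⁻¹ *ᵥ S := by
  have hu : IsUnit M.det := hM.det_pos.ne'.isUnit
  have hMt : Mᵀ = M := by
    have := hM.1
    simpa [Matrix.IsHermitian] using this
  have h := hM.posSemidef.dotProduct_mulVec_nonneg (z - M⁻¹ *ᵥ S)
  have e1 : M *ᵥ (M⁻¹ *ᵥ S) = S := by
    rw [mulVec_mulVec, mul_nonsing_inv _ hu, one_mulVec]
  have e2 : (M⁻¹ *ᵥ S) ⬝ᵥ M *ᵥ z = S ⬝ᵥ z := by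
    rw [aux_dot_symm M hMt, e1, dotProduct_comm]
  simp only [star_trivial, mulVec_sub, dotProduct_sub, sub_dotProduct, e1, e2] at h
  rw [dotProduct_comm z S, dotProduct_comm (M⁻¹ *ᵥ S) S] at h
  linarith

lemma aux_det_le {d : ℕ} (hd : 0 < d) (M : Matrix (Fin d) (Fin d) ℝ) (hM : M.PosDef) :
    M.det ≤ (M.trace / d) ^ d := by
  have hdr : (0 : ℝ) < d := by exact_mod_cast hd
  have h1 : M.det = ∏ i, hM.1.eigenvalues i := by
    simpa using hM.1.det_eq_prod_eigenvalues
  have h2 : M.trace = ∑ i, hM.1.eigenvalues i := by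
    simpa using hM.1.trace_eq_sum_eigenvalues
  have hp : ∀ i, 0 ≤ hM.1.eigenvalues i := fun i => (hM.eigenvalues_pos i).le
  have h := Real.geom_mean_le_arith_mean_weighted Finset.univ (fun _ : Fin d => (1 : ℝ) / d)
    hM.1.eigenvalues (fun i _ => by positivity) (by simp; field_simp) (fun i _ => hp i)
  rw [Real.finsetProd_rpow _ _ (fun i _ => hp i), ← h1, ← Finset.mul_sum, ← h2] at h
  have hD := hM.det_pos
  calc M.det = (M.det ^ ((1 : ℝ) / d)) ^ d := by
        rw [← Real.rpow_natCast, ← Real.rpow_mul hD.le]; field_simp; simp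
    _ ≤ (1 / d * M.trace) ^ d := by gcongr
    _ = _ := by congr 1; ring

lemma aux_rhs (d t : ℕ) (ht : 1 ≤ t) (c a L : ℝ) (hc : 0 < c) (hL : 0 ≤ L) :
    (c ^ (-(1 : ℝ) / 2) * L) ^ d * (t : ℝ) ^ ((1 - a) * d / 2) =
      √((t * L ^ 2 / (c * (t : ℝ) ^ a)) ^ d) := by
  have ht0 : (0 : ℝ) < t := by exact_mod_cast ht
  symm
  rw [Real.sqrt_eq_iff_mul_self_eq (by positivity) (by positivity), ← sq, mul_pow, ← pow_mul,
    mul_comm d 2, pow_mul, ← Real.rpow_natCast ((t : ℝ) ^ ((1 - a) * d / 2)), ← Real.rpow_mul ht0.le]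
  have e1 : (1 - a) * d / 2 * ((2 : ℕ) : ℝ) = (1 - a) * d := by push_cast; ring
  have e2 : (c ^ (-(1 : ℝ) / 2)) ^ 2 = c⁻¹ := by
    rw [← Real.rpow_natCast, ← Real.rpow_mul hc.le]
    norm_num [Real.rpow_neg_one]
  rw [e1, Real.rpow_mul ht0.le, Real.rpow_natCast, ← mul_pow, mul_pow _ L 2, e2, Real.rpow_sub ht0,
    Real.rpow_one]
  congr 1
  field_simp

section auxMain

variable {Ω : Type*} [MeasureSpace Ω] [IsProbabilityMeasure (ℙ : Measure Ω)]

lemma aux_main_ge2 {d : ℕ} (hd : 2 ≤ d)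
    (θ : Fin d → ℝ) (ξ : ℕ → Ω → ℝ) (φ : ℕ → Ω → Fin d → ℝ)
    (hξmeas : ∀ s, Measurable (ξ s)) (hφmeas : ∀ s, Measurable (φ s))
    (hgauss : ∀ s, Measure.map (ξ s) ℙ = gaussianReal 0 1)
    (hindep : ∀ s, Indep (MeasurableSpace.comap (ξ s) inferInstance)
      ((⨆ i ∈ Finset.range (s + 1), MeasurableSpace.comap (φ i) inferInstance) ⊔
       (⨆ i ∈ Finset.range s, MeasurableSpace.comap (ξ i) inferInstance)) ℙ)
    (r : ℕ → Ω → ℝ) (hr : ∀ s ω, r s ω = θ ⬝ᵥ φ s ω + ξ s ω)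
    (A : ℕ → Ω → Matrix (Fin d) (Fin d) ℝ)
    (hA : ∀ t ω, A t ω = ∑ s ∈ Finset.range t, vecMulVec (φ s ω) (φ s ω))
    (θhat : ℕ → Ω → Fin d → ℝ)
    (hθhat : ∀ t ω, θhat t ω = (A t ω)⁻¹.mulVec (∑ s ∈ Finset.range t, r s ω • φ s ω))
    (L : ℝ) (hL : ∀ s ω, ∑ i, φ s ω i ^ 2 ≤ L ^ 2) (t : ℕ) (m : ℝ) (hm : 0 < m)
    (hmin : ∀ᵐ ω ∂ℙ, m ≤ lambdaMin (A t ω)) (ε : ℝ) (hε : 0 < ε) :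
    ℙ {ω | ε ≤ euclNorm (θhat t ω - θ)} ≤
      ENNReal.ofReal (√((t * L ^ 2 / m) ^ d) * Real.exp (-(m * ε ^ 2) / 4)) := by
  have hdr : (2 : ℝ) ≤ d := by exact_mod_cast hd
  set x : ℝ := t * L ^ 2 / m with hx
  have hpsd : ∀ s ω, (A s ω).PosSemidef := fun s ω => by
    rw [hA]; exact aux_psd_sum (fun s => φ s ω) s
  have htr : ∀ ω, (A t ω).trace ≤ m * x := by
    intro ω
    rw [hA, trace_sum]
    have e : m * x = ∑ s ∈ Finset.range t, L ^ 2 := by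
      rw [hx]; simp; field_simp
    rw [e]
    refine Finset.sum_le_sum fun s _ => ?_
    rw [trace_vecMulVec]
    refine le_trans (le_of_eq ?_) (hL s ω)
    simp [dotProduct, sq]
  have hgood : ∀ᵐ ω ∂ℙ, ∀ v : Fin d → ℝ, m * ∑ i, v i ^ 2 ≤ v ⬝ᵥ A t ω *ᵥ v := by
    filter_upwards [hmin] with ω hω
    exact aux_lam _ (hpsd t ω) m hω
  have hxd : (d : ℝ) ≤ x := by
    obtain ⟨ω, hω⟩ := hgood.exists
    have h1 : ∀ i, m ≤ A t ω i i := by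
      intro i
      have := hω (Pi.single i 1)
      have e : ∑ j, (Pi.single i (1 : ℝ) : Fin d → ℝ) j ^ 2 = 1 := by
        rw [Finset.sum_eq_single i] <;> simp +contextual [Pi.single_apply]
      rw [e] at this
      simpa using this
    have h2 : ∑ i : Fin d, m ≤ (A t ω).trace := Finset.sum_le_sum fun i _ => h1 i
    simp at h2
    have h3 := h2.trans (htr ω)
    rw [mul_comm] at h3
    exact le_of_mul_le_mul_left h3 hm
  have hx2 : 2 ≤ x := hdr.trans hxd
  have hMpd : ∀ s ω, (A s ω + m • (1 : Matrix (Fin d) (Fin d) ℝ)).PosDef := fun s ω => by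
    rw [add_comm]
    exact (PosDef.one.smul hm).add_posSemidef (hpsd s ω)
  -- the chain
  let Z : ℕ → Ω → (Fin d → Fin d → ℝ) × (Fin d → ℝ) := fun s ω =>
    (Matrix.of.symm (A s ω + m • (1 : Matrix (Fin d) (Fin d) ℝ)),
      ∑ k ∈ Finset.range s, ξ k ω • φ k ω)
  let step : (Fin d → Fin d → ℝ) × (Fin d → ℝ) → (Fin d → ℝ) → ℝ →
      (Fin d → Fin d → ℝ) × (Fin d → ℝ) := fun z f w =>
    (fun i j => z.1 i j + f i * f j, z.2 + w • f)
  let H : (Fin d → Fin d → ℝ) × (Fin d → ℝ) → ENNReal := fun p => auxH (Matrix.of p.1) p.2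
  have hHm : Measurable H := aux_H_meas
  have hstepm : Measurable (fun p : (((Fin d → Fin d → ℝ) × (Fin d → ℝ)) × (Fin d → ℝ)) × ℝ =>
      step p.1.1 p.1.2 p.2) := by
    refine Continuous.measurable ?_
    simp only [step]
    fun_prop
  have hofstep : ∀ z f w, (Matrix.of (step z f w).1 : Matrix (Fin d) (Fin d) ℝ) =
      Matrix.of z.1 + vecMulVec f f := by
    intro z f w
    ext i j
    simp [step, vecMulVec_apply]
  have hZ : ∀ s ω, Z (s + 1) ω = step (Z s ω) (φ s ω) (ξ s ω) := by
    intro s ω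
    refine Prod.ext ?_ ?_
    · funext i j
      simp only [Z, step, hA, Finset.sum_range_succ]
      simp [vecMulVec_apply]
      ring
    · simp only [Z, step, Finset.sum_range_succ]
  have hchain := aux_chain ξ φ hξmeas hφmeas hgauss hindep Z step hstepm
    (Matrix.of.symm (m • (1 : Matrix (Fin d) (Fin d) ℝ)), 0)
    (fun ω => by simp [Z, hA]) hZ H hHm t (fun s _ ω => by
      have h := aux_onestep _ (hMpd s ω) (φ s ω) (∑ k ∈ Finset.range s, ξ k ω • φ k ω)
      refine le_of_eq ?_
      refine Eq.trans ?_ h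
      refine lintegral_congr fun w => ?_
      simp only [H]
      rw [hofstep]
      simp [Z, step])
  have hH0 : H (Matrix.of.symm (m • (1 : Matrix (Fin d) (Fin d) ℝ)), 0) =
      ENNReal.ofReal (1 / √(m ^ d)) := by
    simp [H, auxH]
  rw [hH0] at hchain
  have hZm : ∀ s, Measurable (Z s) := by
    intro s
    induction s with
    | zero =>
      have : Z 0 = fun _ => (Matrix.of.symm (m • (1 : Matrix (Fin d) (Fin d) ℝ)), 0) := by
        funext ω; simp [Z, hA]
      rw [this]; exact measurable_const
    | succ s ih =>
      have : Z (s + 1) = fun ω => step (Z s ω) (φ s ω) (ξ s ω) := funext (hZ s)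
      rw [this]
      exact hstepm.comp ((ih.prodMk (hφmeas s)).prodMk (hξmeas s))
  have hxpos : 0 < x := by linarith
  have hcpos : 0 < 1 / √((m * x) ^ d) * Real.exp (m * ε ^ 2 / 4) := by positivity
  have hmk := aux_markov (fun ω => H (Z t ω)) (hHm.comp (hZm t))
    {ω | ε ≤ euclNorm (θhat t ω - θ)} _ (1 / √(m ^ d)) hcpos (by
      filter_upwards [hgood] with ω hω hev
      replace hev : ε ≤ euclNorm (θhat t ω - θ) := hev
      have hPD : (A t ω).PosDef := aux_posdef _ (hpsd t ω) m hm hω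
      have herr := aux_err θ (fun s => φ s ω) (fun s => ξ s ω) (fun s => r s ω) t
        (fun s => hr s ω) (A t ω) (hA t ω) hPD
      rw [← hθhat] at herr
      set u := θhat t ω - θ with hu
      have hnorm : ε ^ 2 ≤ ∑ i, u i ^ 2 := by
        have h0 : 0 ≤ ∑ i, u i ^ 2 := Finset.sum_nonneg fun i _ => sq_nonneg _
        have : ε ^ 2 ≤ euclNorm u ^ 2 := by gcongr
        rwa [euclNorm, Real.sq_sqrt h0] at this
      have hMM := hMpd t ω
      have hDpos := hMM.det_pos
      simp only [H, Z, auxH, Equiv.apply_symm_apply, ← herr]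
      apply ENNReal.ofReal_le_ofReal
      have hq := aux_quad_lower _ hMM (A t ω *ᵥ u) ((1 / 2 : ℝ) • u)
      have hun := hω u
      have euu : u ⬝ᵥ u = ∑ i, u i ^ 2 := by simp [dotProduct, sq]
      simp only [add_mulVec, mulVec_smul, smul_mulVec, one_mulVec, dotProduct_smul,
        smul_dotProduct, dotProduct_add, smul_eq_mul, euu] at hq
      rw [dotProduct_comm (A t ω *ᵥ u) u] at hq
      have hq2 : m * ε ^ 2 / 4 ≤
          1 / 2 * ((A t ω *ᵥ u) ⬝ᵥ (A t ω + m • (1 : Matrix (Fin d) (Fin d) ℝ))⁻¹ *ᵥ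
            (A t ω *ᵥ u)) := by
        have h5 : m * ε ^ 2 ≤ m * ∑ i, u i ^ 2 := by gcongr
        linarith
      have hdet : (A t ω + m • (1 : Matrix (Fin d) (Fin d) ℝ)).det ≤ (m * x) ^ d := by
        refine (aux_det_le (by omega) _ hMM).trans ?_
        have h6 : (A t ω + m • (1 : Matrix (Fin d) (Fin d) ℝ)).trace ≤ m * x + m * d := by
          rw [trace_add, trace_smul, trace_one]
          simp
          exact htr ω
        have h7 : 0 ≤ (A t ω + m • (1 : Matrix (Fin d) (Fin d) ℝ)).trace :=
          hMM.posSemidef.trace_nonneg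
        have h8 : (A t ω + m • (1 : Matrix (Fin d) (Fin d) ℝ)).trace / d ≤ m * x := by
          rw [div_le_iff₀ (by linarith)]
          have : x + d ≤ x * d := by nlinarith
          nlinarith
        gcongr
      gcongr) hchain
  refine hmk.trans (ENNReal.ofReal_le_ofReal (le_of_eq ?_))
  rw [mul_pow, Real.sqrt_mul (by positivity), neg_div, Real.exp_neg]
  have : √(m ^ d) ≠ 0 := by positivity
  have : √(x ^ d) ≠ 0 := by positivity
  field_simp

lemma aux_main_one
    (θ : Fin 1 → ℝ) (ξ : ℕ → Ω → ℝ) (φ : ℕ → Ω → Fin 1 → ℝ)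
    (hξmeas : ∀ s, Measurable (ξ s)) (hφmeas : ∀ s, Measurable (φ s))
    (hgauss : ∀ s, Measure.map (ξ s) ℙ = gaussianReal 0 1)
    (hindep : ∀ s, Indep (MeasurableSpace.comap (ξ s) inferInstance)
      ((⨆ i ∈ Finset.range (s + 1), MeasurableSpace.comap (φ i) inferInstance) ⊔
       (⨆ i ∈ Finset.range s, MeasurableSpace.comap (ξ i) inferInstance)) ℙ)
    (r : ℕ → Ω → ℝ) (hr : ∀ s ω, r s ω = θ ⬝ᵥ φ s ω + ξ s ω)
    (A : ℕ → Ω → Matrix (Fin 1) (Fin 1) ℝ)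
    (hA : ∀ t ω, A t ω = ∑ s ∈ Finset.range t, vecMulVec (φ s ω) (φ s ω))
    (θhat : ℕ → Ω → Fin 1 → ℝ)
    (hθhat : ∀ t ω, θhat t ω = (A t ω)⁻¹.mulVec (∑ s ∈ Finset.range t, r s ω • φ s ω))
    (L : ℝ) (hL : ∀ s ω, ∑ i, φ s ω i ^ 2 ≤ L ^ 2) (t : ℕ) (m : ℝ) (hm : 0 < m)
    (hmin : ∀ᵐ ω ∂ℙ, m ≤ lambdaMin (A t ω)) (ε : ℝ) (hε : 0 < ε) :
    ℙ {ω | ε ≤ euclNorm (θhat t ω - θ)} ≤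
      ENNReal.ofReal (√((t * L ^ 2 / m) ^ 1) * Real.exp (-(m * ε ^ 2) / 4)) := by
  have hpsd : ∀ s ω, (A s ω).PosSemidef := fun s ω => by
    rw [hA]; exact aux_psd_sum (fun s => φ s ω) s
  have hgood : ∀ᵐ ω ∂ℙ, ∀ v : Fin 1 → ℝ, m * ∑ i, v i ^ 2 ≤ v ⬝ᵥ A t ω *ᵥ v := by
    filter_upwards [hmin] with ω hω
    exact aux_lam _ (hpsd t ω) m hω
  have hsm : √m ^ 2 = m := Real.sq_sqrt hm.le
  have hsp : 0 < √m := Real.sqrt_pos.mpr hm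
  have hAe : ∀ s ω, A s ω 0 0 = ∑ k ∈ Finset.range s, φ k ω 0 ^ 2 := by
    intro s ω
    rw [hA, Matrix.sum_apply]
    simp [vecMulVec_apply, sq]
  have h := aux_onedim ξ φ (fun v => v 0 / √m) (by fun_prop) hξmeas hφmeas hgauss hindep
    (fun s ω => A s ω 0 0 / m) (fun s ω => (∑ k ∈ Finset.range s, φ k ω 0 * ξ k ω) / √m)
    (fun s ω => by
      simp only [hAe, Finset.sum_div, div_pow, hsm])
    (fun s ω => by
      rw [Finset.sum_div]
      refine Finset.sum_congr rfl fun k _ => ?_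
      ring)
    t (by
      filter_upwards [hgood] with ω hω
      have := hω 1
      simp [dotProduct, mulVec] at this
      rw [le_div_iff₀ hm]
      linarith) (m * ε ^ 2) (t * L ^ 2 / m) (by positivity) (fun ω => by
      gcongr
      rw [hAe]
      have e : (t : ℝ) * L ^ 2 = ∑ s ∈ Finset.range t, L ^ 2 := by simp
      rw [e]
      refine Finset.sum_le_sum fun s _ => ?_
      simpa using hL s ω)
  rw [pow_one]
  refine le_trans (measure_mono_ae ?_) h
  filter_upwards [hgood] with ω hω hev
  replace hev : ε ≤ euclNorm (θhat t ω - θ) := hev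
  change m * ε ^ 2 * (A t ω 0 0 / m) ^ 2 ≤ ((∑ k ∈ Finset.range t, φ k ω 0 * ξ k ω) / √m) ^ 2
  have hPD : (A t ω).PosDef := aux_posdef _ (hpsd t ω) m hm hω
  have herr := aux_err θ (fun s => φ s ω) (fun s => ξ s ω) (fun s => r s ω) t
    (fun s => hr s ω) (A t ω) (hA t ω) hPD
  rw [← hθhat] at herr
  set u := θhat t ω - θ with hu
  have hnorm : ε ^ 2 ≤ u 0 ^ 2 := by
    have h0 : 0 ≤ ∑ i, u i ^ 2 := Finset.sum_nonneg fun i _ => sq_nonneg _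
    have : ε ^ 2 ≤ euclNorm u ^ 2 := by gcongr
    rw [euclNorm, Real.sq_sqrt h0] at this
    simpa using this
  have h1 := congrFun herr 0
  have h2 : A t ω 0 0 * u 0 = ∑ k ∈ Finset.range t, φ k ω 0 * ξ k ω := by
    simp [mulVec, dotProduct] at h1
    rw [h1]
    exact Finset.sum_congr rfl fun k _ => mul_comm _ _
  rw [← h2, div_pow, div_pow, hsm, mul_pow]
  have : m * ε ^ 2 * (A t ω 0 0 ^ 2 / m ^ 2) = A t ω 0 0 ^ 2 * ε ^ 2 / m := by field_simp
  rw [this]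
  gcongr

end auxMain

/-- in the sequential linear model, if `λ_min(A_t) ≥ c t^a` a.s. for all
`t ≥ t₀`, then for all `t ≥ t₀` and `ε > 0`,
`ℙ(‖θ̂_t − θ‖ ≥ ε) ≤ (c^{-1/2} L)^d t^{(1−a)d/2} exp(−c ε² t^a / 4)`,
where `L = max_{φ ∈ Φ} ‖φ‖`. -/
theorem stmt_12 {d : ℕ} {Ω : Type*} [MeasureSpace Ω] [IsProbabilityMeasure (ℙ : Measure Ω)]
    (θ : Fin d → ℝ) (ξ : ℕ → Ω → ℝ) (φ : ℕ → Ω → Fin d → ℝ)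
    (Φ : Finset (Fin d → ℝ)) (hΦ : ∀ s ω, φ s ω ∈ Φ)
    (hξmeas : ∀ s, Measurable (ξ s)) (hφmeas : ∀ s, Measurable (φ s))
    (hgauss : ∀ s, Measure.map (ξ s) ℙ = gaussianReal 0 1)
    (hindep : ∀ s, Indep (MeasurableSpace.comap (ξ s) inferInstance)
      ((⨆ i ∈ Finset.range (s + 1), MeasurableSpace.comap (φ i) inferInstance) ⊔
       (⨆ i ∈ Finset.range s, MeasurableSpace.comap (ξ i) inferInstance)) ℙ)
    (r : ℕ → Ω → ℝ) (hr : ∀ s ω, r s ω = θ ⬝ᵥ φ s ω + ξ s ω)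
    (A : ℕ → Ω → Matrix (Fin d) (Fin d) ℝ)
    (hA : ∀ t ω, A t ω = ∑ s ∈ Finset.range t, vecMulVec (φ s ω) (φ s ω))
    (θhat : ℕ → Ω → Fin d → ℝ)
    (hθhat : ∀ t ω, θhat t ω = (A t ω)⁻¹.mulVec (∑ s ∈ Finset.range t, r s ω • φ s ω))
    (L : ℝ) (hL : IsGreatest {x : ℝ | ∃ v ∈ Φ, x = euclNorm v} L)
    (t₀ : ℕ) (ht₀ : 1 ≤ t₀) (c : ℝ) (hc : 0 < c) (a : ℝ) (ha : a ∈ Set.Ioo (0 : ℝ) 1)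
    (hmin : ∀ t ≥ t₀, ∀ᵐ ω ∂ℙ, c * (t : ℝ) ^ a ≤ lambdaMin (A t ω)) :
    ∀ t ≥ t₀, ∀ ε : ℝ, 0 < ε →
      ℙ {ω | ε ≤ euclNorm (θhat t ω - θ)}
        ≤ ENNReal.ofReal ((c ^ (-(1 : ℝ) / 2) * L) ^ d * (t : ℝ) ^ ((1 - a) * d / 2) *
            Real.exp (-(c * ε ^ 2 * (t : ℝ) ^ a) / 4)) := by
  intro t ht ε hε
  have ht1 : 1 ≤ t := ht₀.trans ht
  have ht0 : (0 : ℝ) < t := by exact_mod_cast ht1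
  have hm : 0 < c * (t : ℝ) ^ a := by positivity
  have hL0 : 0 ≤ L := by
    obtain ⟨v, -, rfl⟩ := hL.1
    exact Real.sqrt_nonneg _
  have hLb : ∀ s ω, ∑ i, φ s ω i ^ 2 ≤ L ^ 2 := by
    intro s ω
    have h1 : euclNorm (φ s ω) ≤ L := hL.2 ⟨_, hΦ s ω, rfl⟩
    have h0 : 0 ≤ ∑ i, φ s ω i ^ 2 := Finset.sum_nonneg fun i _ => sq_nonneg _
    have h2 : euclNorm (φ s ω) ^ 2 ≤ L ^ 2 := by
      have : 0 ≤ euclNorm (φ s ω) := Real.sqrt_nonneg _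
      gcongr
    rwa [euclNorm, Real.sq_sqrt h0] at h2
  have e : c * ε ^ 2 * (t : ℝ) ^ a = c * (t : ℝ) ^ a * ε ^ 2 := by ring
  rw [aux_rhs d t ht1 c a L hc hL0, e]
  rcases Nat.lt_or_ge d 2 with hd | hd
  · interval_cases d
    · exfalso
      obtain ⟨ω, hω⟩ := (hmin t ht).exists
      have : IsEmpty {v : Fin 0 → ℝ // ∑ i, v i ^ 2 = 1} := ⟨fun v => by simpa using v.2⟩
      rw [lambdaMin, Real.iInf_of_isEmpty] at hω
      linarith
    · exact aux_main_one θ ξ φ hξmeas hφmeas hgauss hindep r hr A hA θhat hθhat L hLb t _ hm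
        (hmin t ht) ε hε
  · exact aux_main_ge2 hd θ ξ φ hξmeas hφmeas hgauss hindep r hr A hA θhat hθhat L hLb t _ hm
      (hmin t ht) ε hε

end
end
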